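/- Let r, n ∈ ℕ with r < n and k₁,…,k_r ∈ ℕ. There exists a nonempty Zariski open set U ⊆ L_{k₁} × ⋯ × L_{k_r} (in the space of coefficient vectors) such that for every F = (f₁,…,f_r) ∈ U, the zero set V_F := V(f₁,…,f_r) ⊆ A^n is a smooth irreducible variety and deg(T V_F) ≤ (deg(V_F))². -/

import Mathlib

open MvPolynomial

/-- A subset of affine space is an algebraic set if it is the zero locus of an
ideal of polynomials. -/
def IsAlgebraicSet {K : Type} [Field K] {n : ℕ} (W : Set (Fin n → K)) : Prop :=
  ∃ I : Ideal (MvPolynomial (Fin n) K), W = zeroLocus K I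

/-- An irreducible affine variety: an algebraic set whose vanishing ideal is prime. -/
def IsIrreducibleVariety {K : Type} [Field K] {n : ℕ} (W : Set (Fin n → K)) : Prop :=
  IsAlgebraicSet W ∧ (vanishingIdeal K W).IsPrime

/-- The dimension of an affine algebraic set: the Krull dimension of its coordinate ring. -/
noncomputable def varDim {K : Type} [Field K] {n : ℕ} (W : Set (Fin n → K)) : ℕ :=
  ENat.toNat ((ringKrullDim (MvPolynomial (Fin n) K ⧸ vanishingIdeal K W)).unbotD 0)

/-- The (Zariski) tangent space of `W` at `p`:
all `y` with `∇f(p)·y = 0` for every `f ∈ I(W)`. -/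
def tangentSpaceAt {K : Type} [Field K] {n : ℕ} (W : Set (Fin n → K)) (p : Fin n → K) :
    Set (Fin n → K) :=
  {y | ∀ f ∈ vanishingIdeal K W, ∑ i, eval p (pderiv i f) * y i = 0}

/-- The dimension of the tangent space at a point. -/
noncomputable def tangentDimAt {K : Type} [Field K] {n : ℕ} (W : Set (Fin n → K))
    (p : Fin n → K) : ℕ :=
  Module.finrank K (Submodule.span K (tangentSpaceAt W p))

/-- A point of an (irreducible) variety is a smooth point when the tangent space has
the dimension of the variety. -/
def IsSmoothAt {K : Type} [Field K] {n : ℕ} (W : Set (Fin n → K)) (p : Fin n → K) : Prop :=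
  tangentDimAt W p = varDim W

/-- A variety is smooth if it is smooth at each of its points. -/
def IsSmoothVariety {K : Type} [Field K] {n : ℕ} (W : Set (Fin n → K)) : Prop :=
  ∀ p ∈ W, IsSmoothAt W p

/-- Projection `A^{2n} → A^n` to the first `n` coordinates. -/
def fstProj {K : Type} {n : ℕ} (z : Fin (n + n) → K) : Fin n → K :=
  fun i => z (Fin.castAdd n i)

/-- Projection `A^{2n} → A^n` to the last `n` coordinates. -/
def sndProj {K : Type} {n : ℕ} (z : Fin (n + n) → K) : Fin n → K :=
  fun i => z (Fin.natAdd n i)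

/-- The tangent bundle `TW ⊆ A^{2n}`: pairs `(x, y)` with `x ∈ W` and `y ∈ T_x W`. -/
def tangentBundle {K : Type} [Field K] {n : ℕ} (W : Set (Fin n → K)) :
    Set (Fin (n + n) → K) :=
  {z | fstProj z ∈ W ∧ sndProj z ∈ tangentSpaceAt W (fstProj z)}

/-- Zariski closure of a subset of affine space. -/
def zclosure {K : Type} [Field K] {n : ℕ} (W : Set (Fin n → K)) : Set (Fin n → K) :=
  zeroLocus K (vanishingIdeal K W)

/-- The tangential variety `Tan(W)`: the Zariski closure of `π₂(TW)`. -/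
def tangentialVariety {K : Type} [Field K] {n : ℕ} (W : Set (Fin n → K)) :
    Set (Fin n → K) :=
  zclosure (sndProj '' tangentBundle W)

/-- The geometric degree of an (irreducible) affine algebraic set: the maximal finite
number of points in an intersection with an affine-linear subspace of complementary
dimension. -/
noncomputable def geomDegree {K : Type} [Field K] {n : ℕ} (W : Set (Fin n → K)) : ℕ :=
  sSup {m | ∃ L : AffineSubspace K (Fin n → K),
    Module.finrank K L.direction = n - varDim W ∧
    (W ∩ (L : Set (Fin n → K))).Finite ∧ (W ∩ (L : Set (Fin n → K))).ncard = m}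

/-- A linear variety: an affine-linear subspace of affine space. -/
def IsLinearVariety {K : Type} [Field K] {n : ℕ} (W : Set (Fin n → K)) : Prop :=
  ∃ L : AffineSubspace K (Fin n → K), W = (L : Set (Fin n → K))

/-- A line: an affine-linear subspace of dimension 1. -/
def IsLine {K : Type} [Field K] {n : ℕ} (W : Set (Fin n → K)) : Prop :=
  ∃ L : AffineSubspace K (Fin n → K), W = (L : Set (Fin n → K)) ∧
    Module.finrank K L.direction = 1

open Classical in
/-- `ω(C)`: the number of points in the fiber of `π₂ : TC → Tan(C)` over a generic
point of `Tan(C)`; it is `0` when `C` is a line. -/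
noncomputable def omegaCurve {K : Type} [Field K] {n : ℕ} (C : Set (Fin n → K)) : ℕ :=
  if IsLine C then 0
  else sInf {m | ∃ Z : Set (Fin n → K), IsAlgebraicSet Z ∧ ¬ tangentialVariety C ⊆ Z ∧
    ∀ v ∈ tangentialVariety C \ Z,
      {z ∈ tangentBundle C | sndProj z = v}.ncard = m}

/-- A smooth irreducible algebraic curve. -/
def IsSmoothCurve {K : Type} [Field K] {n : ℕ} (C : Set (Fin n → K)) : Prop :=
  IsIrreducibleVariety C ∧ varDim C = 1 ∧ IsSmoothVariety C

set_option linter.unusedSectionVars false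


section FreePart
variable {σ : Type} [Fintype σ] {R S : Type} [CommRing R] [CommRing S]

/-- the generalized monomial attached to an exponent vector -/
noncomputable def gmon (k : σ → ℕ) (G : σ → MvPolynomial σ R) (α : σ →₀ ℕ) : MvPolynomial σ R :=
  (∏ i, G i ^ (α i / k i)) * ∏ i, X i ^ (α i % k i)

/-- the linear endomorphism sending monomials to generalized monomials -/
noncomputable def gend (k : σ → ℕ) (G : σ → MvPolynomial σ R) :
    MvPolynomial σ R →ₗ[R] MvPolynomial σ R :=
  (basisMonomials σ R).constr R (gmon k G)

/-- exponents of bounded degree -/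
abbrev DegIdx (σ : Type) (d : ℕ) : Type := {α : σ →₀ ℕ // α.degree ≤ d}

instance degIdxFinite (d : ℕ) : Finite (DegIdx σ d) :=
  (Finsupp.finite_of_degree_le (σ := σ) d).to_subtype

noncomputable instance degIdxFintype (d : ℕ) : Fintype (DegIdx σ d) := Fintype.ofFinite _

/-- matrix of `gend` on polynomials of degree at most `d` -/
noncomputable def gmat (k : σ → ℕ) (G : σ → MvPolynomial σ R) (d : ℕ) :
    Matrix (DegIdx σ d) (DegIdx σ d) R :=
  fun α' α => coeff α'.1 (gmon k G α.1)

open Classical in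
/-- the discriminating element -/
noncomputable def gdet (k : σ → ℕ) (G : σ → MvPolynomial σ R) : R :=
  ∏ d ∈ Finset.range ((∑ i, (k i - 1)) + 2), (gmat k G d).det

lemma gend_monomial (k : σ → ℕ) (G : σ → MvPolynomial σ R) (α : σ →₀ ℕ) (c : R) :
    gend k G (monomial α c) = c • gmon k G α := by
  have : monomial α c = c • (basisMonomials σ R) α := by
    simp [smul_monomial]
  rw [this, map_smul, gend, Module.Basis.constr_basis]

lemma map_gmon (φ : R →+* S) (k : σ → ℕ) (G : σ → MvPolynomial σ R) (α : σ →₀ ℕ) :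
    map φ (gmon k G α) = gmon k (fun i => map φ (G i)) α := by
  simp [gmon, map_prod]

lemma map_gdet (φ : R →+* S) (k : σ → ℕ) (G : σ → MvPolynomial σ R) :
    φ (gdet k G) = gdet k (fun i => map φ (G i)) := by
  classical
  simp only [gdet, map_prod]
  refine Finset.prod_congr rfl fun d _ => ?_
  rw [RingHom.map_det]
  congr 1
  ext a b
  simp [gmat, ← map_gmon, coeff_map]

lemma gmon_pow (k : σ → ℕ) (α : σ →₀ ℕ) :
    gmon k (fun i => (X i : MvPolynomial σ R) ^ k i) α = monomial α 1 := by
  rw [gmon, ← Finset.prod_mul_distrib, monomial_eq, C_1, one_mul, Finsupp.prod_fintype]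
  · refine Finset.prod_congr rfl fun i _ => ?_
    rw [← pow_mul, ← pow_add, Nat.div_add_mod]
  · simp

lemma gdet_pow (k : σ → ℕ) :
    gdet k (fun i => (X i : MvPolynomial σ R) ^ k i) = 1 := by
  classical
  rw [gdet]
  refine Finset.prod_eq_one fun d _ => ?_
  convert Matrix.det_one (n := DegIdx σ d) (R := R)
  ext a b
  simp only [gmat, gmon_pow, coeff_monomial, Matrix.one_apply]
  simp [Subtype.ext_iff, eq_comm]

lemma totalDegree_le_iff_degree (p : MvPolynomial σ R) (d : ℕ) :
    p.totalDegree ≤ d ↔ ∀ α, coeff α p ≠ 0 → α.degree ≤ d := by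
  rw [totalDegree, Finset.sup_le_iff]
  simp only [mem_support_iff]
  rfl

lemma totalDegree_gmon_le {k : σ → ℕ} {G : σ → MvPolynomial σ R}
    (hG : ∀ i, (G i).totalDegree ≤ k i) (α : σ →₀ ℕ) :
    (gmon k G α).totalDegree ≤ α.degree := by
  refine (totalDegree_mul _ _).trans ?_
  have h1 : (∏ i, G i ^ (α i / k i)).totalDegree ≤ ∑ i, (α i / k i) * k i := by
    refine (totalDegree_finsetProd _ _).trans (Finset.sum_le_sum fun i _ => ?_)
    exact (totalDegree_pow _ _).trans (Nat.mul_le_mul_left _ (hG i))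
  have h2 : (∏ i, (X i : MvPolynomial σ R) ^ (α i % k i)).totalDegree ≤ ∑ i, (α i % k i) := by
    refine (totalDegree_finsetProd _ _).trans (Finset.sum_le_sum fun i _ => ?_)
    refine (totalDegree_pow _ _).trans ?_
    have : (X i : MvPolynomial σ R).totalDegree ≤ 1 := by
      rcases subsingleton_or_nontrivial R with h | h
      · rw [Subsingleton.elim (X i : MvPolynomial σ R) 0]; simp
      · simp
    simpa using Nat.mul_le_mul_left (α i % k i) this
  calc _ ≤ ∑ i, (α i / k i) * k i + ∑ i, (α i % k i) := add_le_add h1 h2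
    _ = ∑ i, α i := by
      rw [← Finset.sum_add_distrib]
      exact Finset.sum_congr rfl fun i _ => Nat.div_add_mod' _ _
    _ = α.degree := (Finsupp.degree_eq_sum α).symm

lemma coeff_gend (k : σ → ℕ) (G : σ → MvPolynomial σ R) (d : ℕ) (p : MvPolynomial σ R)
    (hp : p.totalDegree ≤ d) (a : DegIdx σ d) :
    coeff a.1 (gend k G p) = (gmat k G d).mulVec (fun b => coeff b.1 p) a := by
  classical
  conv_lhs => rw [as_sum p]
  simp only [map_sum, gend_monomial, coeff_sum, coeff_smul, Matrix.mulVec, dotProduct, gmat,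
    smul_eq_mul]
  have : p.support ⊆ (Finset.univ : Finset (DegIdx σ d)).image Subtype.val := by
    intro α hα
    have := (totalDegree_le_iff_degree p d).1 hp α (by simpa using hα)
    simp [this]
  rw [Finset.sum_subset this, Finset.sum_image]
  · exact Finset.sum_congr rfl fun b _ => mul_comm _ _
  · intro x _ y _ h; exact Subtype.ext h
  · intro x _ hx
    simp at hx
    simp [hx]

lemma totalDegree_gend_le {k : σ → ℕ} {G : σ → MvPolynomial σ R}
    (hG : ∀ i, (G i).totalDegree ≤ k i) (d : ℕ) (p : MvPolynomial σ R)
    (hp : p.totalDegree ≤ d) : (gend k G p).totalDegree ≤ d := by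
  rw [as_sum p, map_sum]
  refine totalDegree_finsetSum_le fun α hα => ?_
  rw [gend_monomial]
  refine (totalDegree_smul_le _ _).trans ((totalDegree_gmon_le hG α).trans ?_)
  exact (totalDegree_le_iff_degree p d).1 hp α (by simpa using hα)

/-- polynomial with given coefficients -/
noncomputable def ofCoeffs (d : ℕ) (c : DegIdx σ d → R) : MvPolynomial σ R :=
  ∑ b, monomial b.1 (c b)

lemma coeff_ofCoeffs (d : ℕ) (c : DegIdx σ d → R) (b : DegIdx σ d) :
    coeff b.1 (ofCoeffs d c) = c b := by
  classical
  simp only [ofCoeffs, coeff_sum, coeff_monomial, ← Subtype.ext_iff]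
  simp

lemma totalDegree_ofCoeffs (d : ℕ) (c : DegIdx σ d → R) :
    (ofCoeffs d c).totalDegree ≤ d := by
  refine totalDegree_finsetSum_le fun b _ => ?_
  refine (totalDegree_monomial_le _ _).trans ?_
  exact b.2

lemma ext_deg (d : ℕ) (p q : MvPolynomial σ R) (hp : p.totalDegree ≤ d) (hq : q.totalDegree ≤ d)
    (h : ∀ a : DegIdx σ d, coeff a.1 p = coeff a.1 q) : p = q := by
  ext α
  by_cases hα : α.degree ≤ d
  · exact h ⟨α, hα⟩
  · have h1 : coeff α p = 0 := by
      by_contra h1; exact hα ((totalDegree_le_iff_degree p d).1 hp α h1)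
    have h2 : coeff α q = 0 := by
      by_contra h1; exact hα ((totalDegree_le_iff_degree q d).1 hq α h1)
    rw [h1, h2]

lemma surj_iff {k : σ → ℕ} {G : σ → MvPolynomial σ R}
    (hG : ∀ i, (G i).totalDegree ≤ k i) (d : ℕ) :
    Function.Surjective (gmat k G d).mulVec ↔
      ∀ p : MvPolynomial σ R, p.totalDegree ≤ d → ∃ c, c.totalDegree ≤ d ∧ gend k G c = p := by
  constructor
  · intro h p hp
    obtain ⟨c, hc⟩ := h (fun b => coeff b.1 p)
    refine ⟨ofCoeffs d c, totalDegree_ofCoeffs d c, ?_⟩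
    refine ext_deg d _ _ (totalDegree_gend_le hG d _ (totalDegree_ofCoeffs d c)) hp fun a => ?_
    rw [coeff_gend k G d _ (totalDegree_ofCoeffs d c)]
    simp only [coeff_ofCoeffs]
    exact congrFun hc a
  · intro h v
    obtain ⟨c, hc, hcv⟩ := h (ofCoeffs d v) (totalDegree_ofCoeffs d v)
    refine ⟨fun b => coeff b.1 c, ?_⟩
    ext a
    rw [← coeff_gend k G d c hc, hcv, coeff_ofCoeffs]

lemma surj_step {k : σ → ℕ} (hk : ∀ i, 0 < k i) {G : σ → MvPolynomial σ R}
    (h : ∀ d ≤ (∑ i, (k i - 1)) + 1, ∀ p : MvPolynomial σ R, p.totalDegree ≤ d →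
      ∃ c, c.totalDegree ≤ d ∧ gend k G c = p) (d : ℕ) :
    ∀ p : MvPolynomial σ R, p.totalDegree ≤ d → ∃ c, c.totalDegree ≤ d ∧ gend k G c = p := by
  induction d with
  | zero => exact h 0 (Nat.zero_le _)
  | succ d ih =>
    -- the submodule of good elements
    let W : Submodule R (MvPolynomial σ R) := (restrictTotalDegree σ R (d+1)).map (gend k G)
    have hW : ∀ p, p ∈ W ↔ ∃ c, c.totalDegree ≤ d + 1 ∧ gend k G c = p := by
      intro p; simp only [W, Submodule.mem_map, mem_restrictTotalDegree]
    -- multiplication by a variable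
    have hX : ∀ (j : σ) (p : MvPolynomial σ R), p.totalDegree ≤ d → X j * p ∈ W := by
      intro j p hp
      obtain ⟨c, hc, rfl⟩ := ih p hp
      rw [as_sum c, map_sum, Finset.mul_sum]
      refine Submodule.sum_mem _ fun β hβ => ?_
      have hβd := (totalDegree_le_iff_degree c d).1 hc β (by simpa using hβ)
      rw [gend_monomial, mul_smul_comm]
      refine Submodule.smul_mem _ _ ?_
      have e1 : X j * gmon k G β = (∏ i, G i ^ (β i / k i)) * (X j * ∏ i, X i ^ (β i % k i)) := by
        rw [gmon]; ring
      have hd1 : (X j * ∏ i, (X i : MvPolynomial σ R) ^ (β i % k i)).totalDegree ≤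
          (∑ i, β i % k i) + 1 := by
        have : X j * ∏ i, (X i : MvPolynomial σ R) ^ (β i % k i) =
            monomial (Finsupp.single j 1 + Finsupp.equivFunOnFinite.symm (fun i => β i % k i)) 1 := by
          rw [monomial_single_add, pow_one, monomial_eq, C_1, one_mul, Finsupp.prod_fintype]
          · simp
          · simp
        rw [this]
        refine (totalDegree_monomial_le _ _).trans ?_
        change Finsupp.degree _ ≤ _
        rw [map_add, Finsupp.degree_single, Finsupp.degree_eq_sum]
        simp [add_comm]
      have hle : ∑ i, β i % k i ≤ ∑ i, (k i - 1) :=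
        Finset.sum_le_sum fun i _ => Nat.le_sub_one_of_lt (Nat.mod_lt _ (hk i))
      obtain ⟨c', hc', hcc⟩ := h ((∑ i, β i % k i) + 1) (by omega) _ hd1
      rw [e1, ← hcc, as_sum c', map_sum, Finset.mul_sum]
      refine Submodule.sum_mem _ fun δ hδ => ?_
      have hδd := (totalDegree_le_iff_degree c' _).1 hc' δ (by simpa using hδ)
      rw [gend_monomial, mul_smul_comm]
      refine Submodule.smul_mem _ _ ((hW _).2 ?_)
      let γ : σ →₀ ℕ := Finsupp.equivFunOnFinite.symm (fun i => δ i + k i * (β i / k i))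
      refine ⟨monomial γ 1, ?_, ?_⟩
      · refine (totalDegree_monomial_le _ _).trans ?_
        change Finsupp.degree γ ≤ _
        rw [Finsupp.degree_eq_sum] at hβd hδd ⊢
        simp only [γ, Finsupp.equivFunOnFinite_symm_apply_apply, Finset.sum_add_distrib]
        have : ∑ i, β i = ∑ i, k i * (β i / k i) + ∑ i, β i % k i := by
          rw [← Finset.sum_add_distrib]
          exact Finset.sum_congr rfl fun i _ => (Nat.div_add_mod _ _).symm
        omega
      · rw [gend_monomial, one_smul, gmon, gmon, ← mul_assoc, ← Finset.prod_mul_distrib]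
        have e3 : ∀ i, γ i / k i = β i / k i + δ i / k i := by
          intro i
          simp only [γ, Finsupp.equivFunOnFinite_symm_apply_apply]
          rw [Nat.add_mul_div_left _ _ (hk i), add_comm]
        have e4 : ∀ i, γ i % k i = δ i % k i := by
          intro i
          simp [γ]
        simp only [e3, e4, pow_add, Finset.prod_mul_distrib]
    intro p hp
    rw [← hW, as_sum p]
    refine Submodule.sum_mem _ fun α hα => ?_
    have hαd := (totalDegree_le_iff_degree p _).1 hp α (by simpa using hα)
    by_cases hα0 : ∀ j, α j = 0
    · have : α = 0 := by ext j; exact hα0 j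
      subst this
      obtain ⟨c, hc, hc2⟩ := ih (monomial 0 (coeff 0 p))
        ((totalDegree_monomial_le _ _).trans (by simp))
      exact (hW _).2 ⟨c, by omega, hc2⟩
    · push Not at hα0
      obtain ⟨j, hj⟩ := hα0
      have hs : α = Finsupp.single j 1 + (α - Finsupp.single j 1) := by
        rw [add_tsub_cancel_of_le]
        simpa using Nat.one_le_iff_ne_zero.2 hj
      rw [hs, monomial_single_add, pow_one]
      refine hX j _ ((totalDegree_monomial_le _ _).trans ?_)
      change Finsupp.degree _ ≤ d
      have := congrArg Finsupp.degree hs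
      rw [map_add, Finsupp.degree_single] at this
      omega

theorem gend_bijective {k : σ → ℕ} (hk : ∀ i, 0 < k i) {G : σ → MvPolynomial σ R}
    (hG : ∀ i, (G i).totalDegree ≤ k i) (hu : IsUnit (gdet k G)) :
    Function.Bijective (gend k G) := by
  classical
  have h1 : ∀ d ≤ (∑ i, (k i - 1)) + 1, Function.Surjective (gmat k G d).mulVec := by
    intro d hd
    rw [Matrix.mulVec_surjective_iff_isUnit, Matrix.isUnit_iff_isUnit_det]
    refine isUnit_of_dvd_unit ?_ hu
    rw [gdet]
    convert Finset.dvd_prod_of_mem _ (Finset.mem_range.2 (show d < (∑ i, (k i - 1)) + 2 by omega))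
    congr!
  have h2 := surj_step hk (fun d hd => (surj_iff hG d).1 (h1 d hd))
  constructor
  · rw [injective_iff_map_eq_zero]
    intro p hp
    have h3 := (surj_iff hG p.totalDegree).2 (h2 _)
    rw [Matrix.mulVec_surjective_iff_isUnit] at h3
    have h4 := Matrix.mulVec_injective_of_isUnit h3
    have h5 : (fun b : DegIdx σ p.totalDegree => coeff b.1 p) = 0 := by
      apply h4
      ext a
      rw [← coeff_gend k G _ p le_rfl, hp]
      simp
    exact ext_deg p.totalDegree _ _ le_rfl (by simp) fun a => by simpa using congrFun h5 a
  · intro p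
    obtain ⟨c, _, hc⟩ := h2 p.totalDegree p le_rfl
    exact ⟨c, hc⟩

/-- the basis of generalized monomials -/
noncomputable def gbasis {k : σ → ℕ} (hk : ∀ i, 0 < k i) {G : σ → MvPolynomial σ R}
    (hG : ∀ i, (G i).totalDegree ≤ k i) (hu : IsUnit (gdet k G)) :
    Module.Basis (σ →₀ ℕ) R (MvPolynomial σ R) :=
  (basisMonomials σ R).map (LinearEquiv.ofBijective (gend k G) (gend_bijective hk hG hu))

lemma gbasis_apply {k : σ → ℕ} (hk : ∀ i, 0 < k i) {G : σ → MvPolynomial σ R}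
    (hG : ∀ i, (G i).totalDegree ≤ k i) (hu : IsUnit (gdet k G)) (α : σ →₀ ℕ) :
    gbasis hk hG hu α = gmon k G α := by
  simp [gbasis, gend_monomial]

end FreePart


section BasisPart
variable {ι τ : Type} [Fintype ι] [Fintype τ] {R S : Type} [CommRing R] [CommRing S]

/-- extended degree vector -/
abbrev kk (τ : Type) (k : ι → ℕ) : ι ⊕ τ → ℕ := Sum.elim k (fun _ => 1)

/-- extended system -/
noncomputable abbrev GG (F : ι → MvPolynomial (ι ⊕ τ) R) : ι ⊕ τ → MvPolynomial (ι ⊕ τ) R :=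
  Sum.elim F (fun j => X (Sum.inr j))

/-- the discriminating element of a system -/
noncomputable abbrev qdet (k : ι → ℕ) (F : ι → MvPolynomial (ι ⊕ τ) R) : R := gdet (kk τ k) (GG F)

lemma map_qdet (φ : R →+* S) (k : ι → ℕ) (F : ι → MvPolynomial (ι ⊕ τ) R) :
    φ (qdet k F) = qdet k (fun i => map φ (F i)) := by
  rw [qdet, map_gdet, qdet]
  congr 1
  ext1 i
  rcases i with i | i <;> simp

lemma qdet_pow (k : ι → ℕ) :
    qdet k (fun i => (X (Sum.inl i) : MvPolynomial (ι ⊕ τ) R) ^ k i) = 1 := by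
  rw [qdet, ← gdet_pow (R := R) (kk τ k)]
  congr 1
  ext1 i
  rcases i with i | i <;> simp

lemma kk_pos {k : ι → ℕ} (hk : ∀ i, 0 < k i) : ∀ i, 0 < kk τ k i := by
  rintro (i | i) <;> simp [hk]

lemma GG_deg {k : ι → ℕ} {F : ι → MvPolynomial (ι ⊕ τ) R}
    (hF : ∀ i, (F i).totalDegree ≤ k i) : ∀ i, (GG F i).totalDegree ≤ kk τ k i := by
  rintro (i | i)
  · simp [hF]
  · rcases subsingleton_or_nontrivial R with h | h
    · simp only [Sum.elim_inr]
      rw [Subsingleton.elim (X (Sum.inr i) : MvPolynomial (ι ⊕ τ) R) 0]; simp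
    · simp

/-- the coordinate ring -/
def BB (F : ι → MvPolynomial (ι ⊕ τ) R) : Type := MvPolynomial (ι ⊕ τ) R ⧸ Ideal.span (Set.range F)

noncomputable instance (F : ι → MvPolynomial (ι ⊕ τ) R) : CommRing (BB F) :=
  inferInstanceAs (CommRing (MvPolynomial (ι ⊕ τ) R ⧸ Ideal.span (Set.range F)))

/-- the quotient map -/
noncomputable def bmk (F : ι → MvPolynomial (ι ⊕ τ) R) : MvPolynomial (ι ⊕ τ) R →+* BB F :=
  Ideal.Quotient.mk (Ideal.span (Set.range F))

lemma bmk_surj (F : ι → MvPolynomial (ι ⊕ τ) R) : Function.Surjective (bmk F) :=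
  Ideal.Quotient.mk_surjective

lemma bmk_eq_zero {F : ι → MvPolynomial (ι ⊕ τ) R} {p} :
    bmk F p = 0 ↔ p ∈ Ideal.span (Set.range F) := Ideal.Quotient.eq_zero_iff_mem

noncomputable instance (F : ι → MvPolynomial (ι ⊕ τ) R) : Algebra (MvPolynomial τ R) (BB F) :=
  ((bmk F).comp (rename Sum.inr).toRingHom).toAlgebra

lemma bb_smul (F : ι → MvPolynomial (ι ⊕ τ) R) (g : MvPolynomial τ R) (p) :
    g • bmk F p = bmk F (rename Sum.inr g * p) := by
  rw [Algebra.smul_def, map_mul]; rfl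

lemma bb_algebraMap (F : ι → MvPolynomial (ι ⊕ τ) R) (g : MvPolynomial τ R) :
    algebraMap (MvPolynomial τ R) (BB F) g = bmk F (rename Sum.inr g) := rfl

/-- the box of exponents -/
abbrev Box (k : ι → ℕ) : Type := ∀ i, Fin (k i)

/-- box monomials -/
noncomputable def boxmon (τ R : Type) [CommRing R] {k : ι → ℕ} (e : Box k) :
    MvPolynomial (ι ⊕ τ) R :=
  ∏ i, X (Sum.inl i) ^ (e i : ℕ)

/-- combined exponent -/
noncomputable def cexp {k : ι → ℕ} (e : Box k) (β : τ →₀ ℕ) : ι ⊕ τ →₀ ℕ :=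
  Finsupp.equivFunOnFinite.symm (Sum.elim (fun i => (e i : ℕ)) β)

lemma gmon_cexp {k : ι → ℕ} (F : ι → MvPolynomial (ι ⊕ τ) R)
    (e : Box k) (β : τ →₀ ℕ) :
    gmon (kk τ k) (GG F) (cexp e β) = rename Sum.inr (monomial β 1) * boxmon τ R e := by
  rw [gmon, Fintype.prod_sum_type, Fintype.prod_sum_type, rename_monomial, monomial_eq]
  have h1 : ∀ i, (e i : ℕ) / k i = 0 := fun i => Nat.div_eq_of_lt (e i).2
  have h2 : ∀ i, (e i : ℕ) % k i = e i := fun i => Nat.mod_eq_of_lt (e i).2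
  have h3 : (Finsupp.mapDomain Sum.inr β).prod
      (fun n e => (X n : MvPolynomial (ι ⊕ τ) R) ^ e) = ∏ x, X (Sum.inr x) ^ β x := by
    rw [Finsupp.prod_mapDomain_index_inj Sum.inr_injective, Finsupp.prod_fintype]
    simp
  simp [cexp, h1, h2, Nat.mod_one, boxmon, h3]

open Classical in
/-- the projection to coordinates -/
noncomputable def bproj {k : ι → ℕ} (hk : ∀ i, 0 < k i) {F : ι → MvPolynomial (ι ⊕ τ) R}
    (hF : ∀ i, (F i).totalDegree ≤ k i) (hu : IsUnit (qdet k F)) :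
    MvPolynomial (ι ⊕ τ) R →ₗ[R] (Box k → MvPolynomial τ R) :=
  (gbasis (kk_pos (τ := τ) hk) (GG_deg hF) hu).constr R (fun α =>
    if ∀ i, α (Sum.inl i) < k i then
      Pi.single (fun i => ⟨α (Sum.inl i) % k i, Nat.mod_lt _ (hk i)⟩)
        (monomial (Finsupp.equivFunOnFinite.symm fun j => α (Sum.inr j)) 1)
    else 0)

open Classical in
lemma bproj_gmon {k : ι → ℕ} (hk : ∀ i, 0 < k i) {F : ι → MvPolynomial (ι ⊕ τ) R}
    (hF : ∀ i, (F i).totalDegree ≤ k i) (hu : IsUnit (qdet k F)) (α : ι ⊕ τ →₀ ℕ) :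
    bproj hk hF hu (gmon (kk τ k) (GG F) α) =
    (if ∀ i, α (Sum.inl i) < k i then
      Pi.single (fun i => ⟨α (Sum.inl i) % k i, Nat.mod_lt _ (hk i)⟩)
        (monomial (Finsupp.equivFunOnFinite.symm fun j => α (Sum.inr j)) 1)
    else 0 : Box k → MvPolynomial τ R) := by
  rw [← gbasis_apply (kk_pos (τ := τ) hk) (GG_deg hF) hu, bproj, Module.Basis.constr_basis]

open Classical in
lemma bproj_box {k : ι → ℕ} (hk : ∀ i, 0 < k i) {F : ι → MvPolynomial (ι ⊕ τ) R}
    (hF : ∀ i, (F i).totalDegree ≤ k i) (hu : IsUnit (qdet k F)) (e : Box k)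
    (g : MvPolynomial τ R) :
    bproj hk hF hu (rename Sum.inr g * boxmon τ R e) = Pi.single e g := by
  induction g using MvPolynomial.induction_on' with
  | monomial β c =>
    have : (monomial β c : MvPolynomial τ R) = c • monomial β 1 := by simp [smul_monomial]
    rw [this, map_smul, smul_mul_assoc, map_smul, ← gmon_cexp F, bproj_gmon, if_pos]
    · have e1 : (fun i => ⟨(cexp e β) (Sum.inl i) % k i, Nat.mod_lt _ (hk i)⟩ : Box k) = e := by
        ext i
        simp [cexp, Nat.mod_eq_of_lt (e i).2]
      rw [e1, ← Pi.single_smul]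
      congr 3
      ext j
      simp [cexp]
    · intro i
      simp [cexp]
  | add p q hp hq => rw [map_add, add_mul, map_add, hp, hq, Pi.single_add]

lemma bproj_ideal {k : ι → ℕ} (hk : ∀ i, 0 < k i) {F : ι → MvPolynomial (ι ⊕ τ) R}
    (hF : ∀ i, (F i).totalDegree ≤ k i) (hu : IsUnit (qdet k F)) (p : MvPolynomial (ι ⊕ τ) R)
    (hp : p ∈ Ideal.span (Set.range F)) : bproj hk hF hu p = 0 := by
  classical
  obtain ⟨c, rfl⟩ := Ideal.mem_span_range_iff_exists_fun.1 hp
  rw [map_sum]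
  refine Finset.sum_eq_zero fun i _ => ?_
  have : (bproj hk hF hu) ∘ₗ (LinearMap.mulRight R (F i)) = 0 := by
    apply (gbasis (kk_pos (τ := τ) hk) (GG_deg hF) hu).ext
    intro α
    have : gmon (kk τ k) (GG F) α * F i =
        gmon (kk τ k) (GG F) (α + Finsupp.single (Sum.inl i) (k i)) := by
      rw [gmon, gmon]
      have h1 : ∀ j : ι ⊕ τ, (α + Finsupp.single (Sum.inl i) (k i) : ι ⊕ τ →₀ ℕ) j % kk τ k j = α j % kk τ k j := by
        intro j
        rw [Finsupp.add_apply, Finsupp.single_apply]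
        split_ifs with h
        · subst h; simp
        · simp
      have h2 : ∀ j : ι ⊕ τ, GG F j ^ ((α + Finsupp.single (Sum.inl i) (k i) : ι ⊕ τ →₀ ℕ) j / kk τ k j) =
          GG F j ^ (α j / kk τ k j) * if Sum.inl i = j then F i else 1 := by
        intro j
        rw [Finsupp.add_apply, Finsupp.single_apply]
        split_ifs with h
        · subst h
          simp only [Sum.elim_inl]
          rw [Nat.add_div_right _ (hk i), pow_succ]
        · simp
      simp only [h1, h2, Finset.prod_mul_distrib, Finset.prod_ite_eq, Finset.mem_univ, if_true]
      ring
    rw [gbasis_apply, LinearMap.comp_apply, LinearMap.mulRight_apply, this, bproj_gmon, if_neg]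
    · rfl
    · push Not
      exact ⟨i, by simp⟩
  exact LinearMap.congr_fun this (c i)

/-- basis of the coordinate ring over the polynomial ring -/
noncomputable def bbasis {k : ι → ℕ} (hk : ∀ i, 0 < k i) {F : ι → MvPolynomial (ι ⊕ τ) R}
    (hF : ∀ i, (F i).totalDegree ≤ k i) (hu : IsUnit (qdet k F)) :
    Module.Basis (Box k) (MvPolynomial τ R) (BB F) := by
  classical
  refine Module.Basis.mk (v := fun e => bmk F (boxmon τ R e)) ?_ ?_
  · rw [Fintype.linearIndependent_iff]
    intro g hg
    simp only [bb_smul, ← map_sum] at hg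
    have := bproj_ideal hk hF hu _ (bmk_eq_zero.1 hg)
    simp only [map_sum, bproj_box] at this
    intro e
    have := congrFun this e
    simpa [Finset.sum_apply, Pi.single_apply] using this
  · rintro z -
    obtain ⟨p, rfl⟩ := bmk_surj F z
    rw [← (gbasis (kk_pos (τ := τ) hk) (GG_deg hF) hu).linearCombination_repr p,
      Finsupp.linearCombination_apply, Finsupp.sum, map_sum]
    refine Submodule.sum_mem _ fun α _ => ?_
    rw [gbasis_apply, smul_eq_C_mul, ← rename_C Sum.inr, ← bb_smul]
    refine Submodule.smul_mem _ _ ?_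
    by_cases h : ∀ i, α (Sum.inl i) < k i
    · have : α = cexp (fun i => ⟨α (Sum.inl i), h i⟩ : Box k)
          (Finsupp.equivFunOnFinite.symm fun j => α (Sum.inr j)) := by
        ext i
        rcases i with i | i <;> simp [cexp]
      rw [this, gmon_cexp, ← bb_smul]
      exact Submodule.smul_mem _ _ (Submodule.subset_span ⟨_, rfl⟩)
    · push Not at h
      obtain ⟨i, hi⟩ := h
      have : bmk F (gmon (kk τ k) (GG F) α) = 0 := by
        rw [bmk_eq_zero, gmon]
        refine Ideal.mul_mem_right _ _ ?_
        refine Ideal.mem_of_dvd _ (Finset.dvd_prod_of_mem _ (Finset.mem_univ (Sum.inl i))) ?_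
        refine Ideal.pow_mem_of_mem _ (show GG F (Sum.inl i) ∈ _ from
          Ideal.subset_span (Set.mem_range_self i)) _ ?_
        exact Nat.div_pos hi (hk i)
      rw [this]
      exact Submodule.zero_mem _

lemma bbasis_apply {k : ι → ℕ} (hk : ∀ i, 0 < k i) {F : ι → MvPolynomial (ι ⊕ τ) R}
    (hF : ∀ i, (F i).totalDegree ≤ k i) (hu : IsUnit (qdet k F)) (e : Box k) :
    bbasis hk hF hu e = bmk F (boxmon τ R e) := by
  simp [bbasis]

/-- base change of the coordinate ring -/
noncomputable def bbmap (φ : R →+* S) (F : ι → MvPolynomial (ι ⊕ τ) R) :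
    BB F →+* BB (fun i => map φ (F i)) :=
  Ideal.Quotient.lift _ ((bmk (fun i => map φ (F i))).comp (map φ)) (by
    intro a ha
    rw [RingHom.comp_apply, bmk_eq_zero]
    have := Ideal.mem_map_of_mem (map φ) ha
    rw [Ideal.map_span, ← Set.range_comp] at this
    exact this)

lemma bbmap_bmk (φ : R →+* S) (F : ι → MvPolynomial (ι ⊕ τ) R) (p) :
    bbmap φ F (bmk F p) = bmk _ (map φ p) := rfl

/-- the matrix of multiplication -/
noncomputable def xmat {k : ι → ℕ} (hk : ∀ i, 0 < k i) {F : ι → MvPolynomial (ι ⊕ τ) R}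
    (hF : ∀ i, (F i).totalDegree ≤ k i) (hu : IsUnit (qdet k F)) (p : MvPolynomial (ι ⊕ τ) R) :
    Matrix (Box k) (Box k) (MvPolynomial τ R) := by
  classical exact Algebra.leftMulMatrix (bbasis hk hF hu) (bmk F p)

lemma map_xmat (φ : R →+* S) {k : ι → ℕ} (hk : ∀ i, 0 < k i) {F : ι → MvPolynomial (ι ⊕ τ) R}
    (hF : ∀ i, (F i).totalDegree ≤ k i) (hu : IsUnit (qdet k F))
    (hF' : ∀ i, (map φ (F i)).totalDegree ≤ k i) (hu' : IsUnit (qdet k fun i => map φ (F i)))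
    (p : MvPolynomial (ι ⊕ τ) R) :
    (xmat hk hF hu p).map (map φ) = xmat hk hF' hu' (map φ p) := by
  classical
  ext1 e' e
  rw [Matrix.map_apply, xmat, Algebra.leftMulMatrix_eq_repr_mul, xmat,
    Algebra.leftMulMatrix_eq_repr_mul, bbasis_apply, bbasis_apply]
  have h1 := (bbasis hk hF hu).sum_repr (bmk F p * bmk F (boxmon τ R e))
  have h2 := congrArg (bbmap φ F) h1
  simp only [map_sum, bbasis_apply, bb_smul, map_mul, bbmap_bmk] at h2
  have h3 : ∀ e, map φ (boxmon τ R e : MvPolynomial (ι ⊕ τ) R) = boxmon τ S (k := k) e := by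
    intro e; simp [boxmon, map_prod]
  simp only [h3, map_rename, ← bb_algebraMap, ← Algebra.smul_def,
    ← bbasis_apply hk hF' hu'] at h2
  rw [← bbasis_apply hk hF' hu', ← h2, (bbasis hk hF' hu').repr_sum_self]

end BasisPart


namespace Polynomial
section Openness
open Polynomial

/-- universal monic bivariate polynomial -/
noncomputable def upoly {U : Type} [CommRing U] (d N : ℕ) (u : Fin d × Fin (N + 1) → U) : U[X][X] :=
  X ^ d + ∑ i : Fin d, C (∑ j : Fin (N + 1), C (u (i, j)) * X ^ (j : ℕ)) * X ^ (i : ℕ)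

lemma upoly_map {U V : Type} [CommRing U] [CommRing V] (φ : U →+* V) (d N : ℕ)
    (u : Fin d × Fin (N + 1) → U) :
    (upoly d N u).map (mapRingHom φ) = upoly d N (φ ∘ u) := by
  simp [upoly, Polynomial.map_sum]

lemma upoly_low_degree {U : Type} [CommRing U] (d N : ℕ) (u : Fin d × Fin (N + 1) → U) :
    (∑ i : Fin d, C (∑ j : Fin (N + 1), C (u (i, j)) * X ^ (j : ℕ)) * X ^ (i : ℕ)).degree <
      (d : WithBot ℕ) :=
  degree_sum_fin_lt _

lemma upoly_monic {U : Type} [CommRing U] (d N : ℕ) (u : Fin d × Fin (N + 1) → U) :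
    (upoly d N u).Monic := monic_X_pow_add (upoly_low_degree d N u)

lemma upoly_natDegree {U : Type} [CommRing U] [Nontrivial U] (d N : ℕ)
    (u : Fin d × Fin (N + 1) → U) : (upoly d N u).natDegree = d := by
  refine natDegree_eq_of_degree_eq_some ?_
  rw [upoly, degree_add_eq_left_of_degree_lt, degree_X_pow]
  rw [degree_X_pow]
  exact upoly_low_degree d N u

lemma upoly_coeff {U : Type} [CommRing U] (d N : ℕ) (u : Fin d × Fin (N + 1) → U)
    (i : Fin d) (j : Fin (N + 1)) : ((upoly d N u).coeff i).coeff j = u (i, j) := by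
  have h1 : ∀ x : Fin d, ((i : ℕ) = x) ↔ x = i := fun x => by rw [Fin.ext_iff, eq_comm]
  have h2 : ∀ x : Fin (N + 1), ((j : ℕ) = x) ↔ x = j := fun x => by rw [Fin.ext_iff, eq_comm]
  rw [upoly, coeff_add, coeff_X_pow, if_neg i.2.ne, zero_add, finsetSum_coeff]
  simp only [coeff_C_mul_X_pow, h1, Finset.sum_ite_eq', Finset.mem_univ, if_true, finsetSum_coeff,
    h2]

lemma upoly_of_monic {U : Type} [CommRing U] (N : ℕ) (g : U[X][X]) (hg : g.Monic)
    (hN : ∀ i, (g.coeff i).natDegree ≤ N) :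
    g = upoly g.natDegree N (fun ij => (g.coeff ij.1).coeff ij.2) := by
  conv_lhs => rw [hg.as_sum]
  rw [upoly]
  congr 1
  rw [Finset.sum_range]
  refine Finset.sum_congr rfl fun i _ => ?_
  congr 2
  conv_lhs => rw [as_sum_range_C_mul_X_pow' (p := g.coeff i) (n := N + 1) (Nat.lt_succ_of_le (hN i))]
  rw [Finset.sum_range]

lemma exists_extension {K : Type} [Field K] [IsAlgClosed K] {A U : Type} [CommRing A] [CommRing U]
    [Algebra A U] [Algebra.IsIntegral A U] (a : A →+* K) (ha : Function.Surjective a)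
    (hker : RingHom.ker (algebraMap A U) ≤ RingHom.ker a) :
    ∃ b : U →+* K, b.comp (algebraMap A U) = a := by
  have hmax : (RingHom.ker a).IsMaximal := RingHom.ker_isMaximal_of_surjective a ha
  obtain ⟨Q, hQ, hQP⟩ := Ideal.exists_ideal_over_maximal_of_isIntegral (RingHom.ker a) hker
  let _ : Field (U ⧸ Q) := Ideal.Quotient.field Q
  let f : A →+* U ⧸ Q := (Ideal.Quotient.mk Q).comp (algebraMap A U)
  have hf : RingHom.ker a ≤ RingHom.ker f := by
    intro x hx
    rw [← hQP] at hx
    exact Ideal.Quotient.eq_zero_iff_mem.2 hx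
  let g : K →+* U ⧸ Q := a.liftOfSurjective ha ⟨f, hf⟩
  have hg : g.comp a = f := by
    ext x; exact RingHom.liftOfRightInverse_comp_apply _ _
      (Function.rightInverse_surjInv ha) ⟨f, hf⟩ x
  let _ : Algebra K (U ⧸ Q) := g.toAlgebra
  have hint : Algebra.IsIntegral K (U ⧸ Q) := by
    constructor
    intro z
    obtain ⟨u, rfl⟩ := Ideal.Quotient.mk_surjective z
    obtain ⟨p, hp, hpu⟩ := Algebra.IsIntegral.isIntegral (R := A) u
    refine ⟨p.map a, hp.map a, ?_⟩
    rw [eval₂_map]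
    change eval₂ (g.comp a) _ p = 0
    rw [hg]
    change eval₂ ((Ideal.Quotient.mk Q).comp (algebraMap A U)) _ p = 0
    rw [← hom_eval₂, hpu, map_zero]
  have hbij := IsAlgClosed.algebraMap_bijective_of_isIntegral (k := K) (K := U ⧸ Q)
  let e : K ≃+* U ⧸ Q := RingEquiv.ofBijective (algebraMap K (U ⧸ Q)) hbij
  refine ⟨(e.symm : U ⧸ Q →+* K).comp (Ideal.Quotient.mk Q), ?_⟩
  ext x
  simp only [RingHom.comp_apply, RingHom.coe_coe]
  rw [RingEquiv.symm_apply_eq]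
  exact (RingHom.congr_fun hg x).symm

lemma swap_coeff {K : Type} [CommRing K] (p : K[X][X]) (i j : ℕ) :
    ((Bivariate.swap p).coeff i).coeff j = (p.coeff j).coeff i := by
  induction p using Polynomial.induction_on' with
  | add p q hp hq => simp [hp, hq]
  | monomial n f =>
    rw [Bivariate.swap_monomial, coeff_mul_C, coeff_map, coeff_mul_X_pow', coeff_monomial]
    simp only [coeff_C]
    split_ifs <;> first | omega | simp_all

lemma coeff_natDegree_le_of_mul {K : Type} [Field K] (N : ℕ) (g h : K[X][X]) (hg : g ≠ 0) (hh : h ≠ 0)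
    (hN : ∀ i, ((g * h).coeff i).natDegree ≤ N) (i : ℕ) : (g.coeff i).natDegree ≤ N := by
  have h1 : (Bivariate.swap (g * h)).natDegree ≤ N := by
    rw [natDegree_le_iff_coeff_eq_zero]
    intro n hn
    ext j
    rw [swap_coeff, coeff_zero]
    exact coeff_eq_zero_of_natDegree_lt ((hN j).trans_lt hn)
  have h2 : (Bivariate.swap g).natDegree ≤ N := by
    rw [map_mul, natDegree_mul] at h1
    · omega
    · simpa using hg
    · simpa using hh
  rw [natDegree_le_iff_coeff_eq_zero]
  intro n hn
  rw [← swap_coeff, coeff_eq_zero_of_natDegree_lt (h2.trans_lt hn), coeff_zero]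

lemma fac_integral {A U : Type} [CommRing A] [CommRing U] [Algebra A U] (χ : A[X][X]) (hχ : χ.Monic)
    (g h : U[X][X]) (hg : g.Monic) (hh : h.Monic)
    (hfac : g * h = χ.map (mapRingHom (algebraMap A U))) (i j : ℕ) :
    IsIntegral A ((g.coeff i).coeff j) ∧ IsIntegral A ((h.coeff i).coeff j) := by
  let _ : Algebra A[X] U[X] := Polynomial.algebra A U
  exact ⟨(isIntegral_coeff_of_dvd (R := A[X]) χ g hχ hg ⟨h, hfac.symm⟩ i).coeff j,
    (isIntegral_coeff_of_dvd (R := A[X]) χ h hχ hh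
      ⟨g, by rw [mul_comm h g]; exact hfac.symm⟩ i).coeff j⟩

theorem open_factor {K : Type} [Field K] [IsAlgClosed K] {A : Type} [CommRing A]
    (χ : A[X][X]) (hχ : χ.Monic) (a₀ : A →+* K) (ha₀ : Function.Surjective a₀)
    (hirr : Irreducible (χ.map (mapRingHom a₀))) (N d d' : ℕ) (hd : 0 < d) (hd' : 0 < d') :
    ∃ q : A, q ≠ 0 ∧ ∀ a : A →+* K, a q ≠ 0 → ∀ g h : K[X][X], g.Monic → h.Monic →
      g.natDegree = d → h.natDegree = d' → (∀ i, (g.coeff i).natDegree ≤ N) →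
      (∀ i, (h.coeff i).natDegree ≤ N) → g * h ≠ χ.map (mapRingHom a) := by
  by_contra hcon
  push Not at hcon
  let I := (Fin d × Fin (N + 1)) ⊕ (Fin d' × Fin (N + 1))
  let U0 := MvPolynomial I A
  let g0 : U0[X][X] := upoly d N (fun x => MvPolynomial.X (Sum.inl x))
  let h0 : U0[X][X] := upoly d' N (fun x => MvPolynomial.X (Sum.inr x))
  let w : U0[X][X] := g0 * h0 - χ.map (mapRingHom MvPolynomial.C)
  let J : Ideal U0 := Ideal.span (Set.range fun ij : ℕ × ℕ => (w.coeff ij.1).coeff ij.2)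
  -- J meets A trivially
  have hJ : ∀ q : A, MvPolynomial.C q ∈ J → q = 0 := by
    intro q hq
    by_contra hq0
    obtain ⟨a, haq, g, h, hg, hh, hgd, hhd, hgN, hhN, hgh⟩ := hcon q hq0
    subst hgd hhd
    let b : U0 →+* K := MvPolynomial.eval₂Hom a
      (Sum.elim (fun x => (g.coeff x.1).coeff x.2) (fun x => (h.coeff x.1).coeff x.2))
    have hbC : b.comp MvPolynomial.C = a := by ext x; exact MvPolynomial.eval₂Hom_C _ _ _
    have hbw : w.map (mapRingHom b) = 0 := by
      simp only [w, Polynomial.map_sub, Polynomial.map_mul, g0, h0, upoly_map, Polynomial.map_map]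
      rw [sub_eq_zero, mapRingHom_comp, hbC, ← hgh]
      conv_rhs => rw [upoly_of_monic N g hg hgN, upoly_of_monic N h hh hhN]
      congr 2 <;> ext x <;> exact MvPolynomial.eval₂Hom_X' _ _ _
    have hJb : J ≤ RingHom.ker b := by
      rw [Ideal.span_le]
      rintro _ ⟨⟨i, j⟩, rfl⟩
      have := congrArg (fun p => (p.coeff i).coeff j) hbw
      simpa using this
    have := hJb hq
    apply haq
    rw [← hbC]; exact this
  let U := U0 ⧸ J
  let π : U0 →+* U := Ideal.Quotient.mk J
  have halg : algebraMap A U = π.comp MvPolynomial.C := rfl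
  have hfac : g0.map (mapRingHom π) * h0.map (mapRingHom π) =
      χ.map (mapRingHom (algebraMap A U)) := by
    have : w.map (mapRingHom π) = 0 := by
      ext i j
      simp only [coeff_map, coe_mapRingHom, coeff_zero]
      exact Ideal.Quotient.eq_zero_iff_mem.2 (Ideal.subset_span ⟨(i, j), rfl⟩)
    simp only [w, Polynomial.map_sub, Polynomial.map_mul, Polynomial.map_map, mapRingHom_comp] at this
    rw [halg, ← sub_eq_zero, this]
  have hcoef := fac_integral χ hχ (g0.map (mapRingHom π)) (h0.map (mapRingHom π))
    ((upoly_monic _ _ _).map _) ((upoly_monic _ _ _).map _) hfac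
  have hvar : ∀ x : I, IsIntegral A (π (MvPolynomial.X x)) := by
    rintro (x | x)
    · have := (hcoef x.1 x.2).1
      rw [upoly_map, upoly_coeff] at this
      exact this
    · have := (hcoef x.1 x.2).2
      rw [upoly_map, upoly_coeff] at this
      exact this
  have hint : Algebra.IsIntegral A U := by
    constructor
    intro z
    obtain ⟨p, rfl⟩ := Ideal.Quotient.mk_surjective z
    change IsIntegral A (π p)
    induction p using MvPolynomial.induction_on with
    | C c => exact isIntegral_algebraMap (R := A) (A := U) (x := c)
    | add p q hp hq => rw [map_add]; exact hp.add hq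
    | mul_X p i hp => rw [map_mul]; exact hp.mul (hvar i)
  obtain ⟨b, hb⟩ := exists_extension (U := U) a₀ ha₀ (by
    intro x hx
    have : x = 0 := hJ x (Ideal.Quotient.eq_zero_iff_mem.1 hx)
    rw [this]; exact zero_mem _)
  have hfin := congrArg (fun p => Polynomial.map (mapRingHom b) p) hfac
  simp only [Polynomial.map_mul, Polynomial.map_map, mapRingHom_comp, hb] at hfin
  rw [← hfin] at hirr
  have hm1 : (g0.map (mapRingHom (b.comp π))).natDegree = d := by
    rw [upoly_map, upoly_natDegree]
  have hm2 : (h0.map (mapRingHom (b.comp π))).natDegree = d' := by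
    rw [upoly_map, upoly_natDegree]
  rcases hirr.isUnit_or_isUnit rfl with h | h
  · have := natDegree_eq_zero_of_isUnit h
    omega
  · have := natDegree_eq_zero_of_isUnit h
    omega

theorem open_irreducible {K : Type} [Field K] [IsAlgClosed K] {A : Type} [CommRing A] [IsDomain A]
    (χ : A[X][X]) (hχ : χ.Monic) (a₀ : A →+* K) (ha₀ : Function.Surjective a₀)
    (hirr : Irreducible (χ.map (mapRingHom a₀))) :
    ∃ q : A, q ≠ 0 ∧ ∀ a : A →+* K, a q ≠ 0 → Irreducible (χ.map (mapRingHom a)) := by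
  let N := Finset.sup (Finset.range (χ.natDegree + 1)) (fun i => (χ.coeff i).natDegree)
  have hN : ∀ i, (χ.coeff i).natDegree ≤ N := by
    intro i
    by_cases hi : i ≤ χ.natDegree
    · exact Finset.le_sup (f := fun i => (χ.coeff i).natDegree) (by simp; omega)
    · rw [coeff_eq_zero_of_natDegree_lt (by omega)]; simp
  have hnat : ∀ a : A →+* K, (χ.map (mapRingHom a)).natDegree = χ.natDegree :=
    fun a => hχ.natDegree_map _
  choose q hq0 hq using fun (dd : ℕ × ℕ) => open_factor χ hχ a₀ ha₀ hirr N (dd.1 + 1) (dd.2 + 1)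
    (Nat.succ_pos _) (Nat.succ_pos _)
  refine ⟨∏ dd ∈ Finset.range χ.natDegree ×ˢ Finset.range χ.natDegree, q dd,
    Finset.prod_ne_zero_iff.2 fun dd _ => hq0 dd, fun a ha => ?_⟩
  rw [map_prod, Finset.prod_ne_zero_iff] at ha
  rw [(hχ.map _).irreducible_iff_natDegree]
  refine ⟨fun h1 => ?_, fun g h hg hh hgh => ?_⟩
  · have h2 := hnat a
    rw [h1, natDegree_one, ← hnat a₀] at h2
    exact hirr.not_isUnit (by
      rw [(hχ.map _).natDegree_eq_zero.1 h2.symm]; exact isUnit_one)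
  · by_contra hne
    push Not at hne
    have hdeg : g.natDegree + h.natDegree = χ.natDegree := by
      rw [← hg.natDegree_mul hh, hgh, hnat]
    have hN' : ∀ i, ((g * h).coeff i).natDegree ≤ N := by
      intro i
      rw [hgh, coeff_map, coe_mapRingHom]
      exact natDegree_map_le.trans (hN i)
    refine hq (g.natDegree - 1, h.natDegree - 1) a (ha _ ?_) g h hg hh ?_ ?_
      (coeff_natDegree_le_of_mul N g h hg.ne_zero hh.ne_zero hN')
      (coeff_natDegree_le_of_mul N h g hh.ne_zero hg.ne_zero (by rwa [mul_comm] at hN')) hgh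
    · simp; omega
    · simp; omega
    · simp; omega

end Openness
end Polynomial
open Polynomial (open_irreducible)


namespace Polynomial
section MatrixLemmas
open Polynomial

lemma charpoly_eq_of_irreducible {R n : Type} [CommRing R] [IsDomain R] [IsIntegrallyClosed R]
    [Fintype n] [DecidableEq n] (M : Matrix n n R) (p : R[X]) (hp : p.Monic) (hirr : Irreducible p)
    (hdeg : p.natDegree = Fintype.card n) (h0 : aeval M p = 0) : M.charpoly = p := by
  let L := FractionRing R
  have hinj : Function.Injective (algebraMap R L) := IsFractionRing.injective R L
  apply Polynomial.map_injective _ hinj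
  rw [← Matrix.charpoly_map]
  have hirrL := (hp.irreducible_iff_irreducible_map_fraction_map (K := L)).1 hirr
  set M' := M.map (algebraMap R L) with hM'
  have h1 : aeval M' (p.map (algebraMap R L)) = 0 := by
    have := congrArg ((algebraMap R L).mapMatrix) h0
    rw [map_zero] at this
    rw [← this, aeval_map_algebraMap]
    have e := Polynomial.aeval_algHom_apply ((Algebra.ofId R L).mapMatrix (m := n)) M p
    exact e
  have hpos : 0 < Fintype.card n := by
    rw [← hdeg]
    by_contra hcon
    have h1 : p = 1 := hp.natDegree_eq_zero.1 (by omega)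
    exact hirr.not_isUnit (h1 ▸ isUnit_one)
  have hne : Nonempty n := Fintype.card_pos_iff.1 hpos
  have h2 : minpoly L M' = p.map (algebraMap R L) :=
    (minpoly.eq_of_irreducible_of_monic hirrL h1 (hp.map _)).symm
  have h3 : minpoly L M' ∣ M'.charpoly := Matrix.minpoly_dvd_charpoly M'
  rw [h2] at h3
  refine (Polynomial.eq_of_monic_of_dvd_of_natDegree_le (hp.map _) M'.charpoly_monic h3 ?_)
  rw [Matrix.charpoly_natDegree_eq_dim, hp.natDegree_map, hdeg]

lemma commuting_zero {L n : Type} [Field L] [Fintype n] [DecidableEq n] (M Z W : Matrix n n L)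
    (hirr : Irreducible M.charpoly) (hZ : Commute Z M) (hZW : Z * W = 0) (hW : W ≠ 0) : Z = 0 := by
  obtain ⟨u, hu⟩ : ∃ u, W.mulVec u ≠ 0 := by
    by_contra hcon
    push Not at hcon
    apply hW
    exact Matrix.ext_of_mulVec_single fun i => by rw [hcon]; exact (Matrix.zero_mulVec _).symm
  set v := W.mulVec u with hv
  have hZv : Z.mulVec v = 0 := by rw [hv, Matrix.mulVec_mulVec, hZW, Matrix.zero_mulVec]
  have hli : LinearIndependent L (fun i : Fin (Fintype.card n) => (M ^ (i : ℕ)).mulVec v) := by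
    rw [Fintype.linearIndependent_iff]
    intro g hg
    set f : L[X] := ∑ i : Fin (Fintype.card n), C (g i) * X ^ (i : ℕ) with hf
    have hfd : f.degree < (Fintype.card n : WithBot ℕ) := degree_sum_fin_lt _
    have hfv : (aeval M f).mulVec v = 0 := by
      rw [hf, map_sum, Matrix.sum_mulVec, ← hg]
      refine Finset.sum_congr rfl fun i _ => ?_
      simp [Algebra.algebraMap_eq_smul_one, Matrix.smul_mulVec]
    have hf0 : f = 0 := by
      by_contra hf0
      have hcop : IsCoprime M.charpoly f := by
        rw [hirr.coprime_iff_not_dvd]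
        intro hdvd
        have := degree_le_of_dvd hdvd hf0
        rw [Matrix.charpoly_degree_eq_dim] at this
        exact absurd hfd (not_lt.2 this)
      obtain ⟨a, b, hab⟩ := hcop
      have h1 := congrArg (fun q => (aeval M q).mulVec v) hab
      simp only [map_add, map_mul, Matrix.aeval_self_charpoly, mul_zero, zero_add, map_one,
        Matrix.one_mulVec, ← Matrix.mulVec_mulVec, hfv, Matrix.mulVec_zero] at h1
      exact hu h1.symm
    intro i
    have h2 := congrArg (fun q => q.coeff (i : ℕ)) hf0
    have h1 : ∀ x : Fin (Fintype.card n), ((i : ℕ) = x) ↔ x = i :=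
      fun x => by rw [Fin.ext_iff, eq_comm]
    simp only [hf, finsetSum_coeff, coeff_C_mul_X_pow, h1, Finset.sum_ite_eq', Finset.mem_univ,
      if_true, coeff_zero] at h2
    exact h2
  have hspan := hli.span_eq_top_of_card_eq_finrank' (by simp)
  have hZpow : ∀ i : ℕ, Z.mulVec ((M ^ i).mulVec v) = 0 := by
    intro i
    rw [Matrix.mulVec_mulVec, (hZ.pow_right i).eq, ← Matrix.mulVec_mulVec, hZv, Matrix.mulVec_zero]
  have hker : (⊤ : Submodule L (n → L)) ≤ LinearMap.ker (Matrix.mulVecLin Z) := by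
    rw [← hspan, Submodule.span_le]
    rintro _ ⟨i, rfl⟩
    exact hZpow i
  refine Matrix.ext_of_mulVec_single fun i => ?_
  rw [Matrix.zero_mulVec]
  exact hker (Submodule.mem_top)

lemma irr_pow_sub {K : Type} [Field K] (D : ℕ) (hD : 0 < D) (c : K) (hc : c ≠ 0) :
    Irreducible (X ^ D - C (C c * (X + 1)) : K[X][X]) := by
  have hmon : (X ^ D - C (C c * (X + 1)) : K[X][X]).Monic := monic_X_pow_sub_C _ hD.ne'
  have hdeg : (X ^ D - C (C c * (X + 1)) : K[X][X]).natDegree = D := natDegree_X_pow_sub_C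
  have hpr : Prime (X + 1 : K[X]) := by
    have := prime_X_sub_C (-1 : K)
    simpa using this
  have hP : (Ideal.span {(X + 1 : K[X])}).IsPrime := (Ideal.span_singleton_prime hpr.ne_zero).2 hpr
  refine irreducible_of_eisenstein_criterion hP ?_ ?_ ?_ ?_ hmon.isPrimitive
  · rw [hmon.leadingCoeff]
    exact fun h => hP.ne_top ((Ideal.eq_top_iff_one _).2 h)
  · intro n hn
    rw [degree_eq_natDegree hmon.ne_zero, hdeg] at hn
    have hn' : n < D := by exact_mod_cast hn
    rw [coeff_sub, coeff_X_pow, if_neg hn'.ne, zero_sub, coeff_C]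
    split_ifs
    · exact neg_mem (Ideal.mul_mem_left _ _ (Ideal.mem_span_singleton_self _))
    · simp
  · rw [degree_eq_natDegree hmon.ne_zero, hdeg]; exact_mod_cast hD
  · rw [coeff_sub, coeff_X_pow, if_neg hD.ne, zero_sub, coeff_C_zero, Ideal.span_singleton_pow,
      Ideal.mem_span_singleton, dvd_neg, sq]
    rintro ⟨w, hw⟩
    have h1 : C c * (X + 1) = (X + 1) * ((X + 1) * w) := by rw [hw]; ring
    rw [mul_comm] at h1
    have h2 := mul_left_cancel₀ hpr.ne_zero h1
    have h3 := congrArg (eval (-1)) h2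
    simp at h3
    exact hc h3

end MatrixLemmas
end Polynomial
open Polynomial (charpoly_eq_of_irreducible commuting_zero irr_pow_sub)


lemma lmm_irrel {R S m : Type} [CommRing R] [CommRing S] [Algebra R S] (d1 d2 : DecidableEq m)
    (f1 f2 : Fintype m) (b : Module.Basis m R S) (x : S) :
    @Algebra.leftMulMatrix R S _ _ _ m f1 d1 b x = @Algebra.leftMulMatrix R S _ _ _ m f2 d2 b x := by
  obtain rfl : d1 = d2 := Subsingleton.elim _ _
  obtain rfl : f1 = f2 := Subsingleton.elim _ _
  rfl

section XHom
variable {ι τ : Type} [Fintype ι] [DecidableEq ι] [Fintype τ] {R S : Type} [CommRing R] [CommRing S]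

/-- multiplication matrices as a ring homomorphism -/
noncomputable def xhom {k : ι → ℕ} (hk : ∀ i, 0 < k i) {F : ι → MvPolynomial (ι ⊕ τ) R}
    (hF : ∀ i, (F i).totalDegree ≤ k i) (hu : IsUnit (qdet k F)) :
    MvPolynomial (ι ⊕ τ) R →+* Matrix (Box k) (Box k) (MvPolynomial τ R) :=
  (Algebra.leftMulMatrix (bbasis hk hF hu)).toRingHom.comp (bmk F)

variable {k : ι → ℕ} (hk : ∀ i, 0 < k i) {F : ι → MvPolynomial (ι ⊕ τ) R}
    (hF : ∀ i, (F i).totalDegree ≤ k i) (hu : IsUnit (qdet k F))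

lemma xmat_eq (p) : xmat hk hF hu p = xhom hk hF hu p := by
  exact lmm_irrel _ _ _ _ _ _

lemma map_xhom (φ : R →+* S) 
    (hF' : ∀ i, (map φ (F i)).totalDegree ≤ k i) (hu' : IsUnit (qdet k fun i => map φ (F i)))
    (p : MvPolynomial (ι ⊕ τ) R) :
    (xhom hk hF hu p).map (map φ) = xhom hk hF' hu' (map φ p) := by
  rw [← xmat_eq, ← xmat_eq, map_xmat]

lemma xhom_eq_zero {p} (h : xhom hk hF hu p = 0) : bmk F p = 0 := by
  have h1 : Algebra.leftMulMatrix (bbasis hk hF hu) (bmk F p) = 0 := h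
  exact Algebra.leftMulMatrix_injective (bbasis hk hF hu) (by rw [h1, map_zero])

lemma xhom_congr {p q} (h : bmk F p = bmk F q) : xhom hk hF hu p = xhom hk hF hu q := by
  simp only [xhom, RingHom.comp_apply, h]

lemma xhom_F (i) : xhom hk hF hu (F i) = 0 := by
  have : bmk F (F i) = bmk F 0 := by
    rw [map_zero, bmk_eq_zero]; exact Ideal.subset_span ⟨i, rfl⟩
  rw [xhom_congr hk hF hu this, map_zero]

lemma xhom_rename (g : MvPolynomial τ R) :
    xhom hk hF hu (rename Sum.inr g) = algebraMap _ _ g := by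
  rw [xhom, RingHom.comp_apply, ← bb_algebraMap]
  exact (Algebra.leftMulMatrix (bbasis hk hF hu)).commutes g

end XHom

section Chi
variable {r : ℕ} {τ : Type} [Fintype τ] [DecidableEq τ] {R S : Type} [CommRing R] [CommRing S]

/-- auxiliary chain of linear forms -/
noncomputable def ell (R : Type) [CommRing R] (r : ℕ) {τ : Type} (o : τ) :
    ℕ → MvPolynomial (Fin r ⊕ τ) R
  | 0 => X (Sum.inr o) + 1
  | i + 1 => if h : i < r then X (Sum.inl ⟨i, h⟩) else 0

lemma map_ell (φ : R →+* S) (o : τ) (i : ℕ) : map φ (ell R r o i) = ell S r o i := by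
  cases i with
  | zero => simp [ell]
  | succ i => simp only [ell]; split_ifs <;> simp

/-- restriction to a coordinate line -/
noncomputable def sp (R : Type) [CommRing R] (o : τ) : MvPolynomial τ R →+* Polynomial R :=
  eval₂Hom Polynomial.C (fun j => if j = o then Polynomial.X else 0)

lemma map_sp (φ : R →+* S) (o : τ) (p) :
    Polynomial.mapRingHom φ (sp R o p) = sp S o (map φ p) := by
  have : (Polynomial.mapRingHom φ).comp (sp R o) = (sp S o).comp (map φ) := by
    apply MvPolynomial.ringHom_ext
    · intro a; simp [sp]
    · intro i; simp only [sp, RingHom.comp_apply, coe_eval₂Hom, eval₂_X, map_X]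
      split_ifs <;> simp
  exact RingHom.congr_fun this p

variable {k : Fin r → ℕ} (hk : ∀ i, 0 < k i) {F : Fin r → MvPolynomial (Fin r ⊕ τ) R}
    (hF : ∀ i, (F i).totalDegree ≤ k i) (hu : IsUnit (qdet k F)) (o : τ)

/-- matrix of the primitive element restricted to a line -/
noncomputable def cmat : Matrix (Box k) (Box k) (Polynomial R) :=
  (xhom hk hF hu (ell R r o r)).map (sp R o)

/-- characteristic polynomial of the primitive element restricted to a line -/
noncomputable def chi : Polynomial (Polynomial R) := (cmat hk hF hu o).charpoly

lemma map_chi (φ : R →+* S) 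
    (hF' : ∀ i, (map φ (F i)).totalDegree ≤ k i) (hu' : IsUnit (qdet k fun i => map φ (F i))) :
    (chi hk hF hu o).map (Polynomial.mapRingHom φ) = chi hk hF' hu' o := by
  rw [chi, chi, ← Matrix.charpoly_map]
  congr 1
  rw [cmat, cmat, ← map_ell φ, ← map_xhom hk hF hu φ]
  ext1 i j
  simp only [Matrix.map_apply, map_sp]

end Chi

section Special
variable {r : ℕ} {τ : Type} [Fintype τ] [DecidableEq τ] {K : Type} [Field K]

/-- the special system -/
noncomputable def F0 {R : Type} [CommRing R] (k : Fin r → ℕ) (o : τ) (ε : R) (i : Fin r) :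
    MvPolynomial (Fin r ⊕ τ) R := X (Sum.inl i) ^ k i - C ε * ell R r o i

lemma ell_deg {R : Type} [CommRing R] [Nontrivial R] (o : τ) (i : ℕ) :
    (ell R r o i).totalDegree ≤ 1 := by
  cases i with
  | zero =>
    refine (totalDegree_add _ _).trans ?_
    simp
  | succ i =>
    simp only [ell]; split_ifs <;> simp

lemma F0_deg {R : Type} [CommRing R] [Nontrivial R] {k : Fin r → ℕ} (hk : ∀ i, 0 < k i) (o : τ) (ε : R) (i : Fin r) :
    (F0 k o ε i).totalDegree ≤ k i := by
  refine (totalDegree_sub _ _).trans (max_le ?_ ?_)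
  · rw [totalDegree_X_pow]
  · refine (totalDegree_mul _ _).trans ?_
    rw [totalDegree_C, zero_add]
    exact (ell_deg o _).trans (hk i)

lemma exists_eps [Infinite K] (k : Fin r → ℕ) (o : τ) : ∃ ε : K, ε ≠ 0 ∧ qdet k (F0 k o ε) ≠ 0 := by
  set P : Polynomial K := qdet k (F0 k o (Polynomial.X : Polynomial K)) with hP
  have hev : ∀ ε : K, P.eval ε = qdet k (F0 k o ε) := by
    intro ε
    rw [hP, ← Polynomial.coe_evalRingHom, map_qdet]
    congr 1
    ext1 i
    simp [F0, map_ell]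
  have h0 : P ≠ 0 := by
    intro h
    have := hev 0
    rw [h] at this
    have h2 : F0 k o (0 : K) = fun i => X (Sum.inl i) ^ k i := by
      ext1 i; simp [F0]
    rw [h2, qdet_pow] at this
    simp at this
  obtain ⟨ε, hε⟩ : ∃ ε, (Polynomial.X * P).eval ε ≠ 0 := by
    by_contra hcon
    push Not at hcon
    exact mul_ne_zero Polynomial.X_ne_zero h0 (Polynomial.funext fun ε => by simpa using hcon ε)
  rw [Polynomial.eval_mul, Polynomial.eval_X, hev] at hε
  exact ⟨ε, left_ne_zero_of_mul hε, right_ne_zero_of_mul hε⟩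

lemma special_pow (k : Fin r → ℕ) (o : τ) (ε : K) (hε : ε ≠ 0) (j : ℕ) (hj : j ≤ r) :
    ∃ c : K, c ≠ 0 ∧ bmk (F0 k o ε) (ell K r o j ^ (∏ i ∈ Finset.range j, if h : i < r then k ⟨i, h⟩ else 1))
      = bmk (F0 k o ε) (C c * ell K r o 0) := by
  induction j with
  | zero => exact ⟨1, one_ne_zero, by simp⟩
  | succ j ih =>
    obtain ⟨c, hc, h⟩ := ih (by omega)
    have hj' : j < r := by omega
    set D := ∏ i ∈ Finset.range j, if h : i < r then k ⟨i, h⟩ else 1 with hD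
    refine ⟨ε ^ D * c, mul_ne_zero (pow_ne_zero _ hε) hc, ?_⟩
    have h1 : bmk (F0 k o ε) (X (Sum.inl ⟨j, hj'⟩) ^ k ⟨j, hj'⟩) = bmk (F0 k o ε) (C ε * ell K r o j) := by
      rw [← sub_eq_zero, ← map_sub, bmk_eq_zero]
      exact Ideal.subset_span ⟨⟨j, hj'⟩, rfl⟩
    rw [Finset.prod_range_succ, ← hD, dif_pos hj', mul_comm D, pow_mul]
    simp only [ell, dif_pos hj']
    rw [map_pow, h1, ← map_pow, mul_pow, map_mul, h, ← map_mul]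
    simp only [ell, C_mul, C_pow]
    ring_nf

lemma chi_special {k : Fin r → ℕ} (hk : ∀ i, 0 < k i) (o : τ) (ε : K) (hε : ε ≠ 0)
    (hu : IsUnit (qdet k (F0 k o ε))) : Irreducible (chi hk (F0_deg hk o ε) hu o) := by
  obtain ⟨c, hc, h⟩ := special_pow k o ε hε r le_rfl
  have hD : (∏ i ∈ Finset.range r, if h : i < r then k ⟨i, h⟩ else 1) = Fintype.card (Box k) := by
    rw [Finset.prod_range]; simp
  rw [hD] at h
  have hpos : 0 < Fintype.card (Box k) := by
    simp only [Fintype.card_pi, Fintype.card_fin]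
    exact Finset.prod_pos fun i _ => hk i
  set D := Fintype.card (Box k)
  have hirr := irr_pow_sub D hpos c hc
  rw [chi, charpoly_eq_of_irreducible _ _ (Polynomial.monic_X_pow_sub_C _ hpos.ne') hirr
    Polynomial.natDegree_X_pow_sub_C]
  · exact hirr
  have h2 := xhom_congr hk (F0_deg hk o ε) hu h
  have h3 : (C c * ell K r o 0 : MvPolynomial (Fin r ⊕ τ) K) = rename Sum.inr (C c * (X o + 1)) := by
    simp [ell]
  rw [h3, xhom_rename, map_pow] at h2
  have h4 := congrArg (sp K o).mapMatrix h2
  rw [map_pow] at h4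
  have h5 : (sp K o).mapMatrix (xhom hk (F0_deg hk o ε) hu (ell K r o r)) = cmat hk (F0_deg hk o ε) hu o := rfl
  rw [h5] at h4
  rw [map_sub, Polynomial.aeval_C, map_pow, Polynomial.aeval_X, h4, sub_eq_zero]
  rw [Matrix.algebraMap_eq_diagonal, Matrix.algebraMap_eq_diagonal]
  simp [sp]
  

end Special


lemma mapMatrix_algebraMap {A B m : Type} [CommRing A] [CommRing B] [Fintype m] [DecidableEq m]
    (φ : A →+* B) (a : A) :
    φ.mapMatrix (algebraMap A (Matrix m m A) a) = algebraMap B (Matrix m m B) (φ a) := by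
  ext i j
  simp only [RingHom.mapMatrix_apply, Matrix.map_apply, Matrix.algebraMap_matrix_apply]
  split_ifs <;> simp

section Conseq
variable {r : ℕ} {τ : Type} [Fintype τ] [DecidableEq τ] {K : Type} [Field K]
variable {k : Fin r → ℕ} (hk : ∀ i, 0 < k i) {F : Fin r → MvPolynomial (Fin r ⊕ τ) K}
    (hF : ∀ i, (F i).totalDegree ≤ k i) (hu : IsUnit (qdet k F)) (o : τ)

lemma box_nonempty {k : Fin r → ℕ} (hk : ∀ i, 0 < k i) : Nonempty (Box k) :=
  ⟨fun i => ⟨0, hk i⟩⟩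

lemma span_prime (hirr : Irreducible (chi hk hF hu o)) : (Ideal.span (Set.range F)).IsPrime := by
  have hne := box_nonempty hk
  let T := MvPolynomial τ K
  let L := FractionRing T
  have hinj : Function.Injective (algebraMap T L) := IsFractionRing.injective T L
  set X0 := xhom hk hF hu (ell K r o r) with hX0
  have h1 : Irreducible X0.charpoly := by
    refine Polynomial.Monic.irreducible_of_irreducible_map (sp K o) _ X0.charpoly_monic ?_
    rw [← Matrix.charpoly_map]
    exact hirr
  have h2 := (X0.charpoly_monic.irreducible_iff_irreducible_map_fraction_map (K := L)).1 h1
  rw [← Matrix.charpoly_map] at h2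
  have hmi : Function.Injective ((algebraMap T L).mapMatrix (m := Box k)) := by
    intro A B hAB
    ext1 i j
    apply hinj
    exact congrFun (congrFun hAB i) j
  refine ⟨?_, ?_⟩
  · rw [Ne, Ideal.eq_top_iff_one, ← bmk_eq_zero]
    intro h
    have h3 : xhom hk hF hu 1 = xhom hk hF hu 0 := xhom_congr hk hF hu (by rw [h, map_zero])
    rw [map_one, map_zero] at h3
    exact one_ne_zero h3
  · intro a b hab
    rw [or_iff_not_imp_right]
    intro hb
    rw [← bmk_eq_zero]
    apply xhom_eq_zero hk hF hu
    apply hmi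
    rw [map_zero]
    refine commuting_zero ((algebraMap T L).mapMatrix X0) _
      ((algebraMap T L).mapMatrix (xhom hk hF hu b)) h2 ?_ ?_ ?_
    · rw [Commute, SemiconjBy, ← map_mul, ← map_mul, ← map_mul, ← map_mul, mul_comm]
    · rw [← map_mul, ← map_mul]
      rw [xhom_congr hk hF hu (q := 0) (by rw [map_zero]; exact bmk_eq_zero.2 hab)]
      simp
    · intro h
      rw [← map_zero (algebraMap T L).mapMatrix] at h
      exact hb (bmk_eq_zero.1 (xhom_eq_zero hk hF hu (hmi h)))

lemma slice_finite {k : Fin r → ℕ} (hk : ∀ i, 0 < k i) {F : Fin r → MvPolynomial (Fin r ⊕ τ) K}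
    (hF : ∀ i, (F i).totalDegree ≤ k i) (hu : IsUnit (qdet k F)) (e : τ → K) :
    {p : Fin r ⊕ τ → K | (∀ i, eval p (F i) = 0) ∧ ∀ j, p (Sum.inr j) = e j}.Finite := by
  have hne := box_nonempty hk
  let P : Fin r ⊕ τ → Polynomial K := fun z => (xhom hk hF hu (X z)).charpoly.map (eval e)
  refine (Set.Finite.pi fun z => ((P z).rootSet_finite K)).subset ?_
  rintro p ⟨hp, he⟩ z -
  have hmon : (P z).Monic := (Matrix.charpoly_monic _).map _
  rw [Polynomial.mem_rootSet]
  refine ⟨hmon.ne_zero, ?_⟩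
  -- Cayley-Hamilton lifted to the polynomial ring
  let Q : Polynomial (MvPolynomial τ K) := (xhom hk hF hu (X z)).charpoly
  have hCH : xhom hk hF hu (Q.eval₂ (rename Sum.inr).toRingHom (X z)) = 0 := by
    rw [Polynomial.hom_eval₂]
    have : (xhom hk hF hu).comp (rename Sum.inr : MvPolynomial τ K →ₐ[K] MvPolynomial (Fin r ⊕ τ) K).toRingHom
        = algebraMap _ _ := RingHom.ext fun g => xhom_rename hk hF hu g
    rw [this]
    exact Matrix.aeval_self_charpoly _
  have hmem := bmk_eq_zero.1 (xhom_eq_zero hk hF hu hCH)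
  have hle : Ideal.span (Set.range F) ≤ RingHom.ker (eval p) := by
    rw [Ideal.span_le]
    rintro _ ⟨i, rfl⟩
    exact hp i
  have h0 : eval p (Q.eval₂ (rename Sum.inr).toRingHom (X z)) = 0 := hle hmem
  rw [Polynomial.hom_eval₂] at h0
  have : (eval p).comp (rename Sum.inr : MvPolynomial τ K →ₐ[K] MvPolynomial (Fin r ⊕ τ) K).toRingHom
      = eval e := by
    apply MvPolynomial.ringHom_ext
    · intro a; simp
    · intro j; simp [he]
  rw [this, eval_X] at h0
  rw [Polynomial.aeval_def, Polynomial.eval₂_map]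
  exact h0

lemma slice_points [IsAlgClosed K] [CharZero K] (hirr : Irreducible (chi hk hF hu o)) :
    ∃ e : τ → K, ∃ S : Finset (Fin r ⊕ τ → K), S.card = ∏ i, k i ∧
      ∀ p ∈ S, (∀ i, eval p (F i) = 0) ∧ ∀ j, p (Sum.inr j) = e j := by
  classical
  have hne := box_nonempty hk
  set M := cmat hk hF hu o with hM
  set q : Polynomial (Polynomial K) := chi hk hF hu o with hq
  have hmon : q.Monic := Matrix.charpoly_monic _
  set Δ : Polynomial K := (Polynomial.aeval M (Polynomial.derivative q)).det with hΔ
  have hdegq : q.natDegree = ∏ i, k i := by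
    rw [hq, chi, Matrix.charpoly_natDegree_eq_dim]; simp
  have hpos : 0 < q.natDegree := by
    rw [hdegq]; exact Finset.prod_pos fun i _ => hk i
  have hΔ0 : Δ ≠ 0 := by
    let L := FractionRing (Polynomial K)
    have hinj : Function.Injective (algebraMap (Polynomial K) L) := IsFractionRing.injective _ L
    have hirrL := (hmon.irreducible_iff_irreducible_map_fraction_map (K := L)).1 hirr
    have : CharZero L := charZero_of_injective_algebraMap (R := Polynomial K) hinj
    obtain ⟨a, b, hab⟩ := hirrL.separable
    intro h0
    let M' := (algebraMap (Polynomial K) L).mapMatrix M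
    have h1 : Polynomial.aeval M' (q.map (algebraMap (Polynomial K) L)) = 0 := by
      have : q.map (algebraMap (Polynomial K) L) = M'.charpoly := by
        rw [hq, chi, ← Matrix.charpoly_map]; rfl
      rw [this, Matrix.aeval_self_charpoly]
    have h2 : Polynomial.aeval M' (Polynomial.derivative (q.map (algebraMap (Polynomial K) L))) =
        (algebraMap (Polynomial K) L).mapMatrix (Polynomial.aeval M (Polynomial.derivative q)) := by
      rw [Polynomial.derivative_map, Polynomial.aeval_map_algebraMap]
      exact Polynomial.aeval_algHom_apply ((Algebra.ofId (Polynomial K) L).mapMatrix (m := Box k)) M _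
    have h3 := congrArg (fun z => (Polynomial.aeval M' z).det) hab
    simp only [map_add, map_mul, h1, h2, mul_zero, zero_add, Matrix.det_mul, map_one, Matrix.det_one,
      ← RingHom.map_det] at h3
    rw [← hΔ, h0, map_zero, mul_zero] at h3
    exact zero_ne_one h3
  obtain ⟨s, hs⟩ : ∃ s, Δ.eval s ≠ 0 := by
    by_contra hcon
    push Not at hcon
    exact hΔ0 (Polynomial.funext fun ε => by simpa using hcon ε)
  set e : τ → K := fun j => if j = o then s else 0 with he
  have hsp : (Polynomial.evalRingHom s).comp (sp K o) = eval e := by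
    apply MvPolynomial.ringHom_ext
    · intro a; simp [sp]
    · intro j; simp only [sp, RingHom.comp_apply, coe_eval₂Hom, eval₂_X, eval_X, he]
      split_ifs <;> simp
  set Ms : Matrix (Box k) (Box k) K := (Polynomial.evalRingHom s).mapMatrix M with hMs
  set qs : Polynomial K := q.map (Polynomial.evalRingHom s) with hqs
  have hqsc : Ms.charpoly = qs := by rw [hqs, hq, chi, ← Matrix.charpoly_map]; rfl
  have hder : (Polynomial.aeval Ms (Polynomial.derivative qs)).det ≠ 0 := by
    have : Polynomial.aeval Ms (Polynomial.derivative qs) =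
        (Polynomial.evalRingHom s).mapMatrix (Polynomial.aeval M (Polynomial.derivative q)) := by
      rw [hqs, Polynomial.derivative_map, Polynomial.aeval_def, Polynomial.aeval_def,
        Polynomial.eval₂_map, Polynomial.hom_eval₂]
      congr 1
      exact RingHom.ext fun x => (mapMatrix_algebraMap _ _).symm
    rw [this, ← RingHom.map_det]
    exact hs
  have hsing : ∀ t, qs.IsRoot t → (Ms - algebraMap _ _ t).det = 0 := by
    intro t ht
    have h1 : Ms.charpoly.eval t = 0 := by rw [hqsc]; exact ht
    rw [Matrix.eval_charpoly] at h1
    have : Ms - algebraMap K _ t = -(Matrix.scalar (Box k) t - Ms) := by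
      rw [neg_sub]; rfl
    rw [this, Matrix.det_neg, h1, mul_zero]
  have hnod : qs.roots.Nodup := by
    rw [Multiset.nodup_iff_count_le_one]
    intro t
    rw [Polynomial.count_roots]
    by_contra hcon
    push Not at hcon
    rw [Polynomial.one_lt_rootMultiplicity_iff_isRoot (hmon.map _).ne_zero] at hcon
    obtain ⟨G, hG⟩ := Polynomial.dvd_iff_isRoot.2 hcon.2
    apply hder
    rw [hG, map_mul, map_sub, Polynomial.aeval_X, Polynomial.aeval_C, Matrix.det_mul, hsing t hcon.1,
      zero_mul]
  have hcard : qs.roots.toFinset.card = ∏ i, k i := by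
    rw [Multiset.toFinset_card_of_nodup hnod, ← hdegq, ← hmon.natDegree_map (Polynomial.evalRingHom s),
      ← hqs]
    exact (Polynomial.splits_iff_card_roots.1 (IsAlgClosed.splits qs))
  have hpt : ∀ t : K, qs.IsRoot t → ∃ p : Fin r ⊕ τ → K, ((∀ i, eval p (F i) = 0) ∧
      ∀ j, p (Sum.inr j) = e j) ∧ eval p (ell K r o r) = t := by
    intro t ht
    let Ξ : MvPolynomial (Fin r ⊕ τ) K →+* Matrix (Box k) (Box k) K :=
      (eval e).mapMatrix.comp (xhom hk hF hu)
    have hΞξ : Ξ (ell K r o r) = Ms := by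
      rw [hMs, hM, cmat]
      ext i j
      simp only [Ξ, RingHom.comp_apply, RingHom.mapMatrix_apply, Matrix.map_apply, ← hsp]
    have hΞF : ∀ i, Ξ (F i) = 0 := fun i => by
      simp only [Ξ, RingHom.comp_apply, xhom_F, map_zero]
    have hΞr : ∀ g, Ξ (rename Sum.inr g) = algebraMap _ _ (eval e g) := fun g => by
      simp only [Ξ, RingHom.comp_apply, xhom_rename]
      exact mapMatrix_algebraMap _ _
    let J : Ideal (MvPolynomial (Fin r ⊕ τ) K) := Ideal.span (Set.range F) ⊔
      (Ideal.span (Set.range fun j => X (Sum.inr j) - C (e j)) ⊔ Ideal.span {ell K r o r - C t})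
    have hJ : J ≠ ⊤ := by
      intro htop
      have h1 : (1 : MvPolynomial (Fin r ⊕ τ) K) ∈ J := htop ▸ Submodule.mem_top
      obtain ⟨a, ha, b, hb, hab⟩ := Submodule.mem_sup.1 h1
      obtain ⟨b', hb', c, hc, hbc⟩ := Submodule.mem_sup.1 hb
      have ha0 : a ∈ RingHom.ker Ξ := by
        refine (Ideal.span_le.2 ?_) ha
        rintro _ ⟨i, rfl⟩
        exact hΞF i
      have hb0 : b' ∈ RingHom.ker Ξ := by
        refine (Ideal.span_le.2 ?_) hb'
        rintro _ ⟨j, rfl⟩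
        have : (X (Sum.inr j) - C (e j) : MvPolynomial (Fin r ⊕ τ) K) = rename Sum.inr (X j - C (e j)) := by
          simp
        simp only [SetLike.mem_coe, RingHom.mem_ker]
        rw [this, hΞr]; simp
      obtain ⟨d, rfl⟩ := Ideal.mem_span_singleton'.1 hc
      have h2 := congrArg (fun z => (Ξ z).det) hab
      have hCt : Ξ (C t) = algebraMap _ _ t := by
        have := hΞr (C t); simpa using this
      simp only [← hbc, map_add, RingHom.mem_ker.1 ha0, RingHom.mem_ker.1 hb0, zero_add, map_mul,
        map_sub, hΞξ, hCt, Matrix.det_mul, hsing t ht, mul_zero, map_one, Matrix.det_one] at h2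
      exact zero_ne_one h2
    obtain ⟨m, hm, hJm⟩ := Ideal.exists_le_maximal J hJ
    obtain ⟨p, hp⟩ := MvPolynomial.isMaximal_iff_eq_vanishingIdeal_singleton.1 hm
    have hev : ∀ g ∈ J, eval p g = 0 := by
      intro g hg
      have := hJm hg
      rw [hp, mem_vanishingIdeal_singleton_iff] at this
      simpa using this
    refine ⟨p, ⟨fun i => hev _ ?_, fun j => ?_⟩, ?_⟩
    · exact Ideal.mem_sup_left (Ideal.subset_span ⟨i, rfl⟩)
    · have := hev (X (Sum.inr j) - C (e j))
        (Ideal.mem_sup_right (Ideal.mem_sup_left (Ideal.subset_span ⟨j, rfl⟩)))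
      simpa [sub_eq_zero] using this
    · have := hev (ell K r o r - C t)
        (Ideal.mem_sup_right (Ideal.mem_sup_right (Ideal.subset_span rfl)))
      simpa [sub_eq_zero] using this
  have hroot : ∀ t ∈ qs.roots.toFinset, qs.IsRoot t := fun t ht =>
    (Polynomial.mem_roots'.1 (Multiset.mem_toFinset.1 ht)).2
  choose! f hf1 hf2 using hpt
  refine ⟨e, qs.roots.toFinset.image f, ?_, ?_⟩
  · rw [Finset.card_image_of_injOn, hcard]
    intro t ht t' ht' h
    rw [← hf2 t (hroot t ht), ← hf2 t' (hroot t' ht'), h]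
  · intro p hp
    obtain ⟨t, ht, rfl⟩ := Finset.mem_image.1 hp
    exact hf1 t (hroot t ht)

end Conseq


section Univ
variable {r : ℕ} {σ : Type} [Fintype σ] {K : Type} [Field K]

/-- index set of coefficients -/
abbrev CIdx (σ : Type) {r : ℕ} (k : Fin r → ℕ) : Type := Σ i : Fin r, DegIdx σ (k i)

/-- coefficient vector -/
def cf (k : Fin r → ℕ) (F : Fin r → MvPolynomial σ K) : CIdx σ k → K := fun v => coeff v.2.1 (F v.1)

/-- universal system -/
noncomputable def UF (K : Type) [Field K] (σ : Type) [Fintype σ] {r : ℕ} (k : Fin r → ℕ) (i : Fin r) :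
    MvPolynomial σ (MvPolynomial (CIdx σ k) K) :=
  ofCoeffs (k i) (fun b => X ⟨i, b⟩)

lemma UF_deg (k : Fin r → ℕ) (i : Fin r) : (UF K σ k i).totalDegree ≤ k i :=
  totalDegree_ofCoeffs _ _

lemma map_UF {k : Fin r → ℕ} {F : Fin r → MvPolynomial σ K} (hF : ∀ i, (F i).totalDegree ≤ k i)
    (i : Fin r) : map (eval (cf k F)) (UF K σ k i) = F i := by
  have h1 : map (eval (cf k F)) (UF K σ k i) = ofCoeffs (k i) (fun b => coeff b.1 (F i)) := by
    simp [UF, ofCoeffs, cf, map_monomial]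
  rw [h1]
  ext α
  by_cases hα : α.degree ≤ k i
  · exact coeff_ofCoeffs (k i) _ (⟨α, hα⟩ : DegIdx σ (k i))
  · have h2 : coeff α (F i) = 0 := by
      by_contra h1; exact hα ((totalDegree_le_iff_degree _ _).1 (hF i) α h1)
    have h3 : coeff α (ofCoeffs (k i) (fun b : DegIdx σ (k i) => coeff b.1 (F i))) = 0 := by
      by_contra h1; exact hα ((totalDegree_le_iff_degree _ _).1 (totalDegree_ofCoeffs _ _) α h1)
    rw [h2, h3]

end Univ

section OpenGood
variable {r : ℕ} {τ : Type} [Fintype τ] [DecidableEq τ] {K : Type} [Field K]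

lemma chi_congr {R : Type} [CommRing R] {k : Fin r → ℕ} (hk : ∀ i, 0 < k i)
    {F G : Fin r → MvPolynomial (Fin r ⊕ τ) R} (h : F = G)
    (hF : ∀ i, (F i).totalDegree ≤ k i) (hu : IsUnit (qdet k F)) (hF' : ∀ i, (G i).totalDegree ≤ k i)
    (hu' : IsUnit (qdet k G)) (o : τ) : chi hk hF hu o = chi hk hF' hu' o := by
  subst h; rfl

theorem open_good [IsAlgClosed K] {k : Fin r → ℕ} (hk : ∀ i, 0 < k i) (o : τ) :
    ∃ q : MvPolynomial (CIdx (Fin r ⊕ τ) k) K, q ≠ 0 ∧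
      ∀ (F : Fin r → MvPolynomial (Fin r ⊕ τ) K) (hF : ∀ i, (F i).totalDegree ≤ k i),
        eval (cf k F) q ≠ 0 → ∃ hu : IsUnit (qdet k F), Irreducible (chi hk hF hu o) := by
  classical
  let A := MvPolynomial (CIdx (Fin r ⊕ τ) k) K
  let q0 : A := qdet k (UF K (Fin r ⊕ τ) k)
  have hq0 : ∀ (F : Fin r → MvPolynomial (Fin r ⊕ τ) K) (hF : ∀ i, (F i).totalDegree ≤ k i),
      eval (cf k F) q0 = qdet k F := by
    intro F hF
    rw [map_qdet]
    congr 1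
    ext1 i
    exact map_UF hF i
  have : Infinite K := IsAlgClosed.instInfinite
  obtain ⟨ε, hε, hqε⟩ := exists_eps (K := K) k o
  have hF0 := F0_deg hk o ε
  have hq00 : q0 ≠ 0 := by
    intro h; apply hqε; rw [← hq0 _ hF0, h, map_zero]
  let A' := Localization.Away q0
  have hle : Submonoid.powers q0 ≤ nonZeroDivisors A := powers_le_nonZeroDivisors_of_noZeroDivisors hq00
  have : IsDomain A' := IsLocalization.isDomain_localization hle
  let UF' : Fin r → MvPolynomial (Fin r ⊕ τ) A' := fun i => map (algebraMap A A') (UF K (Fin r ⊕ τ) k i)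
  have hUF' : ∀ i, (UF' i).totalDegree ≤ k i := fun i => by
    refine le_trans ?_ (UF_deg (K := K) (σ := Fin r ⊕ τ) k i)
    exact Finset.sup_mono (support_map_subset _ _)
  have huu : IsUnit (qdet k UF') := by
    rw [← map_qdet (algebraMap A A')]
    exact IsLocalization.Away.algebraMap_isUnit q0
  have key : ∀ (F : Fin r → MvPolynomial (Fin r ⊕ τ) K) (hF : ∀ i, (F i).totalDegree ≤ k i)
      (h : IsUnit (eval (cf k F) q0)) (hu : IsUnit (qdet k F)),
      (chi hk hUF' huu o).map (Polynomial.mapRingHom (IsLocalization.Away.lift (S := A') q0 h)) = chi hk hF hu o := by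
    intro F hF h hu
    have e : (fun i => map (IsLocalization.Away.lift (S := A') q0 h) (UF' i)) = F := by
      ext1 i
      simp only [UF', map_map]
      rw [IsLocalization.Away.lift_comp, map_UF hF]
    rw [map_chi hk hUF' huu o _ (fun i => (congrArg totalDegree (congrFun e i)).le.trans (hF i)) (by rw [e]; exact hu)]
    exact chi_congr hk e _ _ _ _ o
  have hu0 : IsUnit (qdet k (F0 k o ε)) := isUnit_iff_ne_zero.2 hqε
  have hev0 : IsUnit (eval (cf k (F0 k o ε)) q0) := by rw [hq0 _ hF0]; exact hu0
  obtain ⟨q', hq', hall⟩ := open_irreducible (chi hk hUF' huu o) (Matrix.charpoly_monic _)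
    (IsLocalization.Away.lift (S := A') q0 hev0) (by
      intro c
      refine ⟨algebraMap A A' (C c), ?_⟩
      rw [IsLocalization.Away.lift_eq, eval_C]) (by
      rw [key _ hF0 hev0 hu0]
      exact chi_special hk o ε hε hu0)
  obtain ⟨⟨a, s⟩, has⟩ := IsLocalization.surj (Submonoid.powers q0) q'
  refine ⟨q0 * a, mul_ne_zero hq00 ?_, ?_⟩
  · rintro rfl
    simp only [map_zero] at has
    exact (mul_ne_zero hq' (IsLocalization.map_units A' s).ne_zero) has
  · intro F hF hne
    rw [map_mul] at hne
    have h1 := left_ne_zero_of_mul hne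
    have h2 := right_ne_zero_of_mul hne
    have hu : IsUnit (qdet k F) := by rw [← hq0 F hF]; exact isUnit_iff_ne_zero.2 h1
    refine ⟨hu, ?_⟩
    rw [← key F hF (isUnit_iff_ne_zero.2 h1) hu]
    apply hall
    intro h0
    have := congrArg (IsLocalization.Away.lift (S := A') q0 (isUnit_iff_ne_zero.2 h1)) has
    rw [map_mul, h0, zero_mul, IsLocalization.Away.lift_eq] at this
    exact h2 this.symm

end OpenGood


section Smooth
variable {r : ℕ} {σ : Type} [Fintype σ] [DecidableEq σ] {K : Type} [Field K]

lemma hom_eval {A B : Type} [CommRing A] [CommRing B] (φ : A →+* B) (g : σ → A) (p : MvPolynomial σ A) :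
    φ (eval g p) = eval (fun i => φ (g i)) (map φ p) := by
  have : φ.comp (eval g) = (eval (fun i => φ (g i))).comp (map φ) := by
    apply MvPolynomial.ringHom_ext
    · intro a; simp
    · intro i; simp
  exact RingHom.congr_fun this p

lemma exists_ker {I P : Type} [Fintype I] [Fintype P] (h : Fintype.card P < Fintype.card I)
    (ψ : MvPolynomial I K →ₐ[K] MvPolynomial P K) : ∃ q, q ≠ 0 ∧ ψ q = 0 := by
  by_contra hcon
  push Not at hcon
  have hinj : Function.Injective ψ := by
    rw [injective_iff_map_eq_zero]
    intro a ha
    by_contra h0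
    exact hcon a h0 ha
  have := _root_.trdeg_le_of_injective ψ hinj
  rw [MvPolynomial.trdeg_of_isDomain, MvPolynomial.trdeg_of_isDomain] at this
  simp at this
  omega

/-- the free coefficients -/
abbrev JI (k : Fin r → ℕ) (s : Fin r) (v : CIdx σ k) : Prop :=
  v.2.1 ≠ 0 ∧ ¬ (v.1 = s ∧ ∃ j, v.2.1 = Finsupp.single j 1)

/-- parameters of the bad locus -/
abbrev PI (σ : Type) [Fintype σ] (k : Fin r → ℕ) (s : Fin r) : Type :=
  {v : CIdx σ k // JI k s v} ⊕ (σ ⊕ {i : Fin r // i ≠ s})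

lemma card_PI (k : Fin r → ℕ) (hk : ∀ i, 0 < k i) (s : Fin r) [Fintype (PI σ k s)] :
    Fintype.card (PI σ k s) < Fintype.card (CIdx σ k) := by
  classical
  have hz : ∀ i : Fin r, (0 : σ →₀ ℕ).degree ≤ k i := fun i => by simp
  have h1 : ∀ j : σ, (Finsupp.single j 1 : σ →₀ ℕ).degree ≤ k s := fun j => by simpa using Nat.succ_le_of_lt (hk s)
  let f : Option (PI σ k s) → CIdx σ k := fun o => match o with
    | none => ⟨s, ⟨0, hz s⟩⟩
    | some (Sum.inl v) => v.1
    | some (Sum.inr (Sum.inl j)) => ⟨s, ⟨Finsupp.single j 1, h1 j⟩⟩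
    | some (Sum.inr (Sum.inr i)) => ⟨i.1, ⟨0, hz i.1⟩⟩
  have hne : ∀ j : σ, (Finsupp.single j 1 : σ →₀ ℕ) ≠ 0 := by intro j; simp
  have hf : Function.Injective f := by
    have key : ∀ v w : CIdx σ k, v = w → v.1 = w.1 ∧ v.2.1 = w.2.1 := by rintro v _ rfl; exact ⟨rfl, rfl⟩
    rintro (_ | ⟨v, hv⟩ | j | ⟨i, hi⟩) (_ | ⟨w, hw⟩ | j' | ⟨i', hi'⟩) h <;> have h' := key _ _ h <;>
      simp only [f] at h'
    · rfl
    · exact absurd h'.2.symm hw.1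
    · exact absurd h'.2.symm (hne _)
    · exact absurd h'.1.symm hi'
    · exact absurd h'.2 hv.1
    · have : v = w := h
      subst this; rfl
    · exact absurd ⟨h'.1, _, h'.2⟩ hv.2
    · exact absurd h'.2 hv.1
    · exact absurd h'.2 (hne _)
    · exact absurd ⟨h'.1.symm, _, h'.2.symm⟩ hw.2
    · rw [Finsupp.single_left_inj one_ne_zero] at h'
      rw [h'.2]
    · exact absurd h'.2 (hne _)
    · exact absurd h'.1 hi
    · exact absurd h'.2.symm hw.1
    · exact absurd h'.2.symm (hne _)
    · have := h'.1
      subst this; rfl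
  have := Fintype.card_le_of_injective f hf
  rw [Fintype.card_option] at this
  omega

lemma split_coeffs {k : Fin r → ℕ} (hk : ∀ i, 0 < k i) (s : Fin r)
    [∀ v : CIdx σ k, Decidable (JI k s v)] {F : Fin r → MvPolynomial σ K}
    (hF : ∀ i, (F i).totalDegree ≤ k i) (i : Fin r) :
    F i = ofCoeffs (k i) (fun b : DegIdx σ (k i) => if JI k s ⟨i, b⟩ then coeff b.1 (F i) else 0) +
      (if i = s then ∑ j, C (coeff (Finsupp.single j 1) (F i)) * X j else 0) + C (coeff 0 (F i)) := by
  apply ext_deg (k i) _ _ (hF i)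
  · refine (totalDegree_add _ _).trans (max_le ((totalDegree_add _ _).trans (max_le ?_ ?_)) ?_)
    · exact totalDegree_ofCoeffs _ _
    · split_ifs
      · refine totalDegree_finsetSum_le fun j _ => ?_
        refine (totalDegree_mul _ _).trans ?_
        rw [totalDegree_C, totalDegree_X]
        have := hk i; omega
      · simp
    · rw [totalDegree_C]; omega
  · intro a
    have e1 : ∀ j : σ, coeff a.1 (X j : MvPolynomial σ K) = if Finsupp.single j 1 = a.1 then 1 else 0 :=
      fun j => coeff_X _ _
    simp only [coeff_add, coeff_ofCoeffs]
    by_cases h0 : a.1 = 0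
    · have : ¬ JI k s ⟨i, a⟩ := fun h => h.1 h0
      rw [if_neg this, h0]
      split_ifs <;> simp [coeff_sum, coeff_C_mul]
    · have hC : coeff a.1 (C (coeff 0 (F i)) : MvPolynomial σ K) = 0 := by
        rw [coeff_C, if_neg (Ne.symm h0)]
      rw [hC, add_zero]
      by_cases h1 : i = s ∧ ∃ j, a.1 = Finsupp.single j 1
      · have : ¬ JI k s ⟨i, a⟩ := fun h => h.2 h1
        obtain ⟨his, j, hj⟩ := h1
        rw [if_neg this, if_pos his, hj, zero_add, coeff_sum, Finset.sum_eq_single j]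
        · simp [coeff_C_mul]
        · intro j' _ hj'
          rw [coeff_C_mul, coeff_X, if_neg, mul_zero]
          rw [Finsupp.single_left_inj one_ne_zero]; exact hj'
        · simp
      · have : JI k s ⟨i, a⟩ := ⟨h0, h1⟩
        rw [if_pos this]
        split_ifs with his
        · rw [coeff_sum, Finset.sum_eq_zero, add_zero]
          intro j _
          rw [coeff_C_mul, e1, if_neg, mul_zero]
          intro hj
          exact h1 ⟨his, j, hj.symm⟩
        · simp

lemma bad_one {k : Fin r → ℕ} (hk : ∀ i, 0 < k i) (s : Fin r) :
    ∃ q : MvPolynomial (CIdx σ k) K, q ≠ 0 ∧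
      ∀ (F : Fin r → MvPolynomial σ K), (∀ i, (F i).totalDegree ≤ k i) →
        ∀ (x : σ → K) (lam : Fin r → K), lam s = 1 → (∀ i, eval x (F i) = 0) →
        (∀ j, ∑ i, lam i * eval x (pderiv j (F i)) = 0) → eval (cf k F) q = 0 := by
  classical
  let _ : Fintype (PI σ k s) := Fintype.ofFinite _
  let CC := MvPolynomial (PI σ k s) K
  let G : Fin r → MvPolynomial σ CC := fun i =>
    ofCoeffs (k i) (fun b : DegIdx σ (k i) => if h : JI k s ⟨i, b⟩ then X (Sum.inl ⟨⟨i, b⟩, h⟩) else 0)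
  let xh : σ → CC := fun j => X (Sum.inr (Sum.inl j))
  let lh : Fin r → CC := fun i => if h : i ≠ s then X (Sum.inr (Sum.inr ⟨i, h⟩)) else 1
  let bh : σ → CC := fun j => - ∑ i, lh i * eval xh (pderiv j (G i))
  let H : Fin r → MvPolynomial σ CC := fun i => G i + if i = s then ∑ j, C (bh j) * X j else 0
  let ch : Fin r → CC := fun i => - eval xh (H i)
  let ψ : MvPolynomial (CIdx σ k) K →ₐ[K] CC := aeval fun v : CIdx σ k =>
    coeff v.2.1 (H v.1 + C (ch v.1))
  obtain ⟨q, hq, hψ⟩ := exists_ker (card_PI k hk s) ψ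
  refine ⟨q, hq, ?_⟩
  intro F hF x lam hs hx hl
  let π : PI σ k s → K := Sum.elim (fun v => cf k F v.1) (Sum.elim x (fun i => lam i.1))
  have hxπ : (fun j => eval π (xh j)) = x := by ext j; simp [xh, π]
  have hlπ : ∀ i, eval π (lh i) = lam i := by
    intro i
    by_cases h : i = s
    · simp [lh, h, hs]
    · simp [lh, h, π]
  have hGπ : ∀ i, map (eval π) (G i) = ofCoeffs (k i)
      (fun b : DegIdx σ (k i) => if JI k s ⟨i, b⟩ then coeff b.1 (F i) else 0) := by
    intro i
    simp only [G, ofCoeffs, map_sum, map_monomial]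
    refine Finset.sum_congr rfl fun b _ => ?_
    congr 1
    by_cases h : JI k s ⟨i, b⟩
    · rw [dif_pos h, if_pos h, eval_X]; rfl
    · rw [dif_neg h, if_neg h, map_zero]
  have hsplit := split_coeffs hk s hF
  have hbπ : ∀ j, eval π (bh j) = coeff (Finsupp.single j 1) (F s) := by
    intro j
    simp only [bh, map_neg, map_sum, map_mul, hlπ, hom_eval, hxπ, ← pderiv_map, hGπ]
    have h1 : ∀ i, lam i * eval x (pderiv j (F i)) = lam i * eval x (pderiv j (ofCoeffs (k i)
      (fun b : DegIdx σ (k i) => if JI k s ⟨i, b⟩ then coeff b.1 (F i) else 0))) +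
        if i = s then coeff (Finsupp.single j 1) (F s) else 0 := by
      intro i
      conv_lhs => rw [hsplit i]
      simp only [map_add, pderiv_C, add_zero, mul_add]
      congr 1
      split_ifs with his
      · subst his
        rw [hs, one_mul, map_sum, map_sum, Finset.sum_eq_single j]
        · simp
        · intro j' _ hj'
          simp [pderiv_X_of_ne hj']
        · simp
      · simp
    have h2 := hl j
    simp only [h1, Finset.sum_add_distrib] at h2
    rw [Finset.sum_ite_eq' Finset.univ s, if_pos (Finset.mem_univ _)] at h2
    exact (eq_neg_of_add_eq_zero_right h2).symm
  have hHπ : ∀ i, F i = map (eval π) (H i) + C (coeff 0 (F i)) := by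
    intro i
    conv_lhs => rw [hsplit i]
    congr 1
    simp only [H, map_add, hGπ]
    congr 1
    split_ifs with his
    · subst his
      simp [hbπ]
    · simp
  have hcπ : ∀ i, eval π (ch i) = coeff 0 (F i) := by
    intro i
    simp only [ch, map_neg, hom_eval, hxπ]
    have := hx i
    rw [hHπ i, map_add, eval_C] at this
    exact (eq_neg_of_add_eq_zero_right this).symm
  have hcomp : eval (cf k F) = (eval π).comp (ψ : MvPolynomial (CIdx σ k) K →+* CC) := by
    apply MvPolynomial.ringHom_ext
    · intro a
      rw [RingHom.comp_apply]
      simp [ψ, CC, algebraMap_eq]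
    · intro v
      rw [RingHom.comp_apply]
      simp only [eval_X, ψ, RingHom.coe_coe, aeval_X]
      rw [← coeff_map, map_add, map_C, hcπ, ← hHπ]; rfl
  rw [hcomp, RingHom.comp_apply]
  simp [hψ]

theorem open_smooth {k : Fin r → ℕ} (hk : ∀ i, 0 < k i) :
    ∃ q : MvPolynomial (CIdx σ k) K, q ≠ 0 ∧
      ∀ (F : Fin r → MvPolynomial σ K), (∀ i, (F i).totalDegree ≤ k i) → eval (cf k F) q ≠ 0 →
        ∀ (x : σ → K), (∀ i, eval x (F i) = 0) →
        LinearIndependent K (fun i : Fin r => fun j : σ => eval x (pderiv j (F i))) := by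
  choose q hq h using fun s => bad_one (K := K) (σ := σ) hk s
  refine ⟨∏ s, q s, Finset.prod_ne_zero_iff.2 fun s _ => hq s, ?_⟩
  intro F hF hne x hx
  rw [Fintype.linearIndependent_iff]
  intro g hg
  by_contra hcon
  push Not at hcon
  obtain ⟨s, hs⟩ := hcon
  rw [map_prod, Finset.prod_ne_zero_iff] at hne
  apply hne s (Finset.mem_univ _)
  refine h s F hF x (fun i => (g s)⁻¹ * g i) (inv_mul_cancel₀ hs) hx ?_
  intro j
  have := congrFun hg j
  simp only [Finset.sum_apply, Pi.smul_apply, smul_eq_mul, Pi.zero_apply] at this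
  simp only [mul_assoc, ← Finset.mul_sum, this, mul_zero]

end Smooth


section Dim
variable {σ : Type} [Fintype σ] [DecidableEq σ] {K : Type} [Field K]

/-- maximal ideal of a point -/
noncomputable abbrev mp (p : σ → K) : Ideal (MvPolynomial σ K) := RingHom.ker (eval p)

/-- linear forms centered at a point -/
noncomputable def lin (p : σ → K) : (σ → K) →ₗ[K] MvPolynomial σ K :=
  ∑ a, (LinearMap.proj a).smulRight (X a - C (p a))

lemma lin_apply (p w : σ → K) : lin p w = ∑ a, C (w a) * (X a - C (p a)) := by
  simp [lin, LinearMap.sum_apply, MvPolynomial.smul_eq_C_mul]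

lemma X_sub_mem (p : σ → K) (a : σ) : X a - C (p a) ∈ mp p := by
  rw [RingHom.mem_ker]; simp

lemma lin_mem (p w : σ → K) : lin p w ∈ mp p := by
  rw [lin_apply]
  exact Ideal.sum_mem _ fun a _ => Ideal.mul_mem_left _ _ (X_sub_mem p a)

lemma taylor (p : σ → K) (f : MvPolynomial σ K) :
    f - C (eval p f) - lin p (fun a => eval p (pderiv a f)) ∈ (mp p) ^ 2 := by
  induction f using MvPolynomial.induction_on with
  | C c => simp [lin_apply]
  | add f g hf hg =>
    have : lin p (fun a => eval p (pderiv a (f + g))) = lin p (fun a => eval p (pderiv a f)) +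
        lin p (fun a => eval p (pderiv a g)) := by
      rw [← map_add]; congr 1; ext a; simp
    rw [this, map_add, C_add]
    convert add_mem hf hg using 1
    ring
  | mul_X g i hg =>
    have h1 : lin p (fun a => eval p (pderiv a (g * X i))) =
        C (p i) * lin p (fun a => eval p (pderiv a g)) + C (eval p g) * (X i - C (p i)) := by
      rw [lin_apply, lin_apply, Finset.mul_sum]
      have : ∀ a, C (eval p (pderiv a (g * X i))) * (X a - C (p a)) =
          C (p i) * (C (eval p (pderiv a g)) * (X a - C (p a))) +
          if a = i then C (eval p g) * (X i - C (p i)) else 0 := by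
        intro a
        by_cases h : a = i
        · subst h; simp; ring
        · rw [if_neg h, pderiv_mul, pderiv_X_of_ne (Ne.symm h)]; simp; ring
      simp only [this, Finset.sum_add_distrib]
      rw [Finset.sum_ite_eq' Finset.univ i, if_pos (Finset.mem_univ _)]
    have h2 : g * X i - C (eval p (g * X i)) - lin p (fun a => eval p (pderiv a (g * X i))) =
        C (p i) * (g - C (eval p g) - lin p (fun a => eval p (pderiv a g))) +
        (g - C (eval p g)) * (X i - C (p i)) := by
      rw [h1, map_mul, eval_X, C_mul]; ring
    rw [h2]
    refine add_mem (Ideal.mul_mem_left _ _ hg) ?_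
    rw [sq]
    exact Ideal.mul_mem_mul (by rw [RingHom.mem_ker]; simp) (X_sub_mem p i)

instance (p : σ → K) : (mp p).IsMaximal :=
  RingHom.ker_isMaximal_of_surjective _ fun c => ⟨C c, by simp⟩

lemma near_max {p : σ → K} {P : Ideal (MvPolynomial σ K)} [hP : P.IsPrime] (hPm : P ≤ mp p)
    {V : Set (σ → K)} (hV : Submodule.span K V = ⊤) (h : ∀ v ∈ V, lin p v ∈ P ⊔ (mp p) ^ 2) :
    P = mp p := by
  have h1 : ∀ w, lin p w ∈ P ⊔ (mp p) ^ 2 := by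
    intro w
    have hle : Submodule.span K V ≤ ((P ⊔ (mp p) ^ 2).restrictScalars K).comap (lin p) := by
      rw [Submodule.span_le]; exact fun v hv => h v hv
    rw [hV] at hle
    exact hle (Submodule.mem_top : w ∈ ⊤)
  have h2 : mp p ≤ P ⊔ mp p • mp p := by
    intro f hf
    have h3 := taylor p f
    rw [RingHom.mem_ker.1 hf, C_0, sub_zero] at h3
    have h4 : f = (f - lin p (fun a => eval p (pderiv a f))) + lin p (fun a => eval p (pderiv a f)) := by
      ring
    rw [h4, smul_eq_mul, ← sq]
    exact add_mem (Ideal.mem_sup_right h3) (h1 _)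
  obtain ⟨g, hg, hgm⟩ := Submodule.exists_sub_one_mem_and_smul_le_of_fg_of_le_sup
    (IsNoetherian.noetherian (mp p)) le_rfl h2
  refine le_antisymm hPm fun f hf => ?_
  have h5 : g * f ∈ P := hgm (Submodule.smul_mem_pointwise_smul f g _ hf)
  rcases hP.mem_or_mem h5 with h6 | h6
  · exfalso
    apply (inferInstance : (mp p).IsMaximal).ne_top
    rw [Ideal.eq_top_iff_one]
    have := sub_mem (hPm h6) hg
    simp at this
  · exact h6

lemma max_eq_mp [IsAlgClosed K] {m : Ideal (MvPolynomial σ K)} (hm : m.IsMaximal) : ∃ p, m = mp p := by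
  obtain ⟨p, hp⟩ := MvPolynomial.isMaximal_iff_eq_vanishingIdeal_singleton.1 hm
  refine ⟨p, ?_⟩
  rw [hp]
  ext f
  rw [mem_vanishingIdeal_singleton_iff, RingHom.mem_ker]
  simp

/-- translation -/
noncomputable def ptrans (p : σ → K) : MvPolynomial σ K ≃+* MvPolynomial σ K :=
  RingEquiv.ofRingHom (eval₂Hom C fun a => X a + C (p a)) (eval₂Hom C fun a => X a - C (p a))
    (by apply MvPolynomial.ringHom_ext <;> intro <;> simp)
    (by apply MvPolynomial.ringHom_ext <;> intro <;> simp)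

lemma eval_ptrans (p q : σ → K) (f) : eval q (ptrans p f) = eval (q + p) f := by
  have : (eval q).comp (ptrans p : MvPolynomial σ K →+* MvPolynomial σ K) = eval (q + p) := by
    apply MvPolynomial.ringHom_ext <;> intro <;> simp [ptrans]
  exact RingHom.congr_fun this f

lemma height_mp [IsAlgClosed K] (p : σ → K) : (mp p).height = Fintype.card σ := by
  have hall : ∀ q : σ → K, (mp q).height = (mp p).height := by
    intro q
    have : mp q = (mp p).comap (ptrans (q - p)) := by
      ext f
      rw [Ideal.mem_comap, RingHom.mem_ker, RingHom.mem_ker]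
      show _ ↔ eval p (ptrans (q - p) f) = 0
      rw [eval_ptrans]; simp
    rw [this]
    exact RingEquiv.height_comap _ _
  have hdim : ringKrullDim (MvPolynomial σ K) = (Fintype.card σ : ℕ) := by
    rw [MvPolynomial.ringKrullDim_of_isNoetherianRing, ringKrullDim_eq_zero_of_field]
    simp
  have h1 : ((mp p).height : WithBot ℕ∞) ≤ ((Fintype.card σ : ℕ) : WithBot ℕ∞) := by
    rw [← hdim]; exact Ideal.height_le_ringKrullDim_of_ne_top (inferInstance : (mp p).IsMaximal).ne_top
  have h2 : ringKrullDim (MvPolynomial σ K) ≤ ((mp p).height : WithBot ℕ∞) := by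
    rw [ringKrullDim_le_iff_isMaximal_height_le]
    intro m hm
    obtain ⟨q, rfl⟩ := max_eq_mp hm
    rw [hall]
  rw [hdim] at h2
  have := le_antisymm h1 h2
  exact_mod_cast this

theorem dim_complete [IsAlgClosed K] {ι : Type} [Fintype ι] (f : ι → MvPolynomial σ K)
    (hne : ∃ p, ∀ i, eval p (f i) = 0)
    (hJ : ∀ p, (∀ i, eval p (f i) = 0) →
      LinearIndependent K (fun i : ι => fun a : σ => eval p (pderiv a (f i)))) :
    ringKrullDim (MvPolynomial σ K ⧸ Ideal.span (Set.range f)) =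
      ((Fintype.card σ - Fintype.card ι : ℕ) : WithBot ℕ∞) ∧ Fintype.card ι ≤ Fintype.card σ := by
  classical
  obtain ⟨p0, hp0⟩ := hne
  have hcard : Fintype.card ι ≤ Fintype.card σ := by
    have := (hJ p0 hp0).fintype_card_le_finrank
    simpa using this
  refine ⟨le_antisymm ?_ ?_, hcard⟩
  · set I := Ideal.span (Set.range f) with hI
    rw [ringKrullDim_le_iff_isMaximal_height_le]
    intro m hm
    have hcm : (m.comap (Ideal.Quotient.mk I)).IsMaximal :=
      Ideal.comap_isMaximal_of_surjective _ Ideal.Quotient.mk_surjective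
    obtain ⟨p, hp⟩ := max_eq_mp hcm
    have hIp : I ≤ mp p := by
      rw [← hp]
      intro g hg
      rw [Ideal.mem_comap, Ideal.Quotient.eq_zero_iff_mem.2 hg]; exact zero_mem _
    have hfp : ∀ i, eval p (f i) = 0 := fun i => hIp (Ideal.subset_span ⟨i, rfl⟩)
    have hli := hJ p hfp
    set v := (fun i : ι => fun a : σ => eval p (pderiv a (f i))) with hv
    obtain ⟨Q, hQ⟩ := Submodule.exists_isCompl (Submodule.span K (Set.range v))
    have hfr : Module.finrank K Q = Fintype.card σ - Fintype.card ι := by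
      have h1 := Submodule.finrank_add_eq_of_isCompl hQ
      rw [finrank_span_eq_card hli] at h1
      simp at h1
      omega
    let b := Module.finBasis K Q
    let l : Fin (Module.finrank K Q) → MvPolynomial σ K ⧸ I := fun j => Ideal.Quotient.mk I (lin p (b j : σ → K))
    have hspan : Submodule.span K (Set.range v ∪ Set.range (fun j => (b j : σ → K))) = ⊤ := by
      rw [Submodule.span_union, ← hQ.sup_eq_top]
      congr 1
      have := congrArg (Submodule.map Q.subtype) b.span_eq
      rw [Submodule.map_span, Submodule.map_top, Submodule.range_subtype, ← Set.range_comp] at this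
      exact this
    have hmin : m ∈ (Ideal.span ((Finset.univ.image l : Finset _) : Set (MvPolynomial σ K ⧸ I))).minimalPrimes := by
      refine ⟨⟨hm.isPrime, ?_⟩, ?_⟩
      · rw [Ideal.span_le]
        intro z hz
        obtain ⟨j, -, rfl⟩ := Finset.mem_image.1 (Finset.mem_coe.1 hz)
        have : lin p (b j : σ → K) ∈ m.comap (Ideal.Quotient.mk I) := hp ▸ lin_mem _ _
        exact this
      · rintro q ⟨hq, hlq⟩ hqm
        have hcq : (q.comap (Ideal.Quotient.mk I)) = mp p := by
          have hqp : (q.comap (Ideal.Quotient.mk I)).IsPrime := Ideal.comap_isPrime _ _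
          refine near_max (hp ▸ Ideal.comap_mono hqm) hspan ?_
          rintro w (⟨i, rfl⟩ | ⟨j, rfl⟩)
          · have h1 := taylor p (f i)
            rw [hfp i, C_0, sub_zero] at h1
            have h2 : f i ∈ q.comap (Ideal.Quotient.mk I) := by
              rw [Ideal.mem_comap, Ideal.Quotient.eq_zero_iff_mem.2 (Ideal.subset_span ⟨i, rfl⟩ : f i ∈ I)]
              exact zero_mem _
            have h3 := sub_mem (Ideal.mem_sup_left (T := (mp p) ^ 2) h2)
              (Ideal.mem_sup_right (S := q.comap (Ideal.Quotient.mk I)) h1)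
            rw [sub_sub_cancel] at h3
            exact h3
          · refine Ideal.mem_sup_left ?_
            rw [Ideal.mem_comap]
            exact hlq (Ideal.subset_span (Finset.mem_coe.2 (Finset.mem_image.2 ⟨j, Finset.mem_univ _, rfl⟩)))
        rw [← hp] at hcq
        exact (Ideal.comap_injective_of_surjective _ Ideal.Quotient.mk_surjective hcq).ge
    have hh := Ideal.height_le_card_of_mem_minimalPrimes_span_finset hmin
    have hc : (Finset.univ.image l).card ≤ Fintype.card σ - Fintype.card ι := by
      refine Finset.card_image_le.trans ?_
      simp [hfr]
    have : m.height ≤ ((Fintype.card σ - Fintype.card ι : ℕ) : ℕ∞) := hh.trans (by exact_mod_cast hc)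
    exact WithBot.coe_le_coe.2 this
  · have h1 := Ideal.height_le_ringKrullDim_quotient_add_encard (p := mp p0) (Set.range f) (by
      rintro _ ⟨i, rfl⟩; exact hp0 i)
    rw [height_mp] at h1
    have h2 : (Set.range f).encard ≤ (Fintype.card ι : ℕ) := by
      rw [← Set.image_univ]
      refine (Set.encard_image_le _ _).trans ?_
      simp [Set.encard_univ]
    generalize ringKrullDim (MvPolynomial σ K ⧸ Ideal.span (Set.range f)) = d at h1
    have h3 : (((Fintype.card σ : ℕ) : ℕ∞) : WithBot ℕ∞) ≤ d + (((Fintype.card ι : ℕ) : ℕ∞) : WithBot ℕ∞) :=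
      h1.trans (by gcongr; exact WithBot.coe_le_coe.2 h2)
    cases d with
    | bot => simp at h3
    | coe d =>
      cases d with
      | top => simp
      | coe d =>
        have h4 : Fintype.card σ ≤ d + Fintype.card ι := by exact_mod_cast h3
        have h5 : Fintype.card σ - Fintype.card ι ≤ d := by omega
        exact WithBot.coe_le_coe.2 (Nat.cast_le.2 h5)

end Dim


section Bezout
variable {σ : Type} [Fintype σ] [DecidableEq σ]

lemma finrank_quot_le {L : Type} [Field L] {d : σ → ℕ} (hd : ∀ i, 0 < d i) {G : σ → MvPolynomial σ L}
    (hG : ∀ i, (G i).totalDegree ≤ d i) (hu : IsUnit (gdet d G)) {ι : Type} [Fintype ι]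
    (v : ι → MvPolynomial σ L ⧸ Ideal.span (Set.range G)) (hv : LinearIndependent L v) :
    Fintype.card ι ≤ ∏ i, d i := by
  classical
  set I := Ideal.span (Set.range G) with hI
  let q : MvPolynomial σ L →ₗ[L] MvPolynomial σ L ⧸ I := (Ideal.Quotient.mkₐ L I).toLinearMap
  let u : (∀ i, Fin (d i)) → MvPolynomial σ L ⧸ I := fun a =>
    q (gmon d G (Finsupp.equivFunOnFinite.symm fun i => (a i : ℕ)))
  have hspan : (⊤ : Submodule L (MvPolynomial σ L ⧸ I)) ≤ Submodule.span L (Set.range u) := by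
    have h1 : (⊤ : Submodule L (MvPolynomial σ L)) ≤ (Submodule.span L (Set.range u)).comap q := by
      rw [← (gbasis hd hG hu).span_eq, Submodule.span_le]
      rintro _ ⟨α, rfl⟩
      rw [gbasis_apply]
      show q (gmon d G α) ∈ Submodule.span L (Set.range u)
      by_cases h : ∀ i, α i < d i
      · refine Submodule.subset_span ⟨fun i => ⟨α i, h i⟩, ?_⟩
        show q (gmon d G _) = q (gmon d G α)
        congr 2
      · push Not at h
        obtain ⟨i, hi⟩ := h
        have : q (gmon d G α) = 0 := by
          show Ideal.Quotient.mk I (gmon d G α) = 0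
          rw [Ideal.Quotient.eq_zero_iff_mem]
          refine Ideal.mul_mem_right _ _ ?_
          rw [← Finset.mul_prod_erase _ _ (Finset.mem_univ i)]
          refine Ideal.mul_mem_right _ _ ?_
          refine Ideal.pow_mem_of_mem _ (Ideal.subset_span (Set.mem_range_self i)) _ ?_
          exact Nat.div_pos hi (hd i)
        rw [this]; exact zero_mem _
    intro z _
    obtain ⟨p, rfl⟩ := Ideal.Quotient.mk_surjective z
    exact h1 (Submodule.mem_top : p ∈ ⊤)
  have hfin : Module.Finite L (MvPolynomial σ L ⧸ I) :=
    ⟨⟨Finset.univ.image u, by rw [Finset.coe_image, Finset.coe_univ, Set.image_univ]; exact top_le_iff.1 hspan⟩⟩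
  have h2 := finrank_range_le_card (R := L) u
  rw [Set.finrank, top_le_iff.1 hspan, finrank_top] at h2
  refine (hv.fintype_card_le_finrank).trans (h2.trans ?_)
  simp

variable {K : Type} [Field K] [IsAlgClosed K]

/-- evaluation at `(0,w)` -/
noncomputable def ev0 (w : σ → K) : MvPolynomial σ (Polynomial K) →+* K :=
  (eval w).comp (map (Polynomial.evalRingHom 0))

lemma ev0_surj (w : σ → K) : Function.Surjective (ev0 w) := fun c => ⟨C (Polynomial.C c), by simp [ev0]⟩

instance (w : σ → K) : (RingHom.ker (ev0 w)).IsMaximal := RingHom.ker_isMaximal_of_surjective _ (ev0_surj w)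

lemma height_ev0 (w : σ → K) : (RingHom.ker (ev0 w)).height = Fintype.card σ + 1 := by
  have h : mp (fun o : Option σ => o.elim 0 w) =
      (RingHom.ker (ev0 w)).comap (optionEquivRight K σ).toRingEquiv := by
    have h2 : (ev0 w).comp ((optionEquivRight K σ).toRingEquiv : MvPolynomial (Option σ) K →+* _) =
        eval (fun o : Option σ => o.elim 0 w) := by
      apply MvPolynomial.ringHom_ext
      · intro c; simp [ev0]
      · rintro (_ | i)
        · simp [ev0]
        · simp [ev0]
    ext f
    rw [mp, ← h2]; rfl
  have h3 := RingEquiv.height_comap (optionEquivRight K σ).toRingEquiv (RingHom.ker (ev0 w))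
  rw [← h3, ← h, height_mp]
  simp

lemma prime_eq_mp (f : σ → MvPolynomial σ K) (hfin : {p | ∀ i, eval p (f i) = 0}.Finite)
    {P : Ideal (MvPolynomial σ K)} (hP : P.IsPrime) (hf : ∀ i, f i ∈ P) {w : σ → K} (hw : P ≤ mp w) :
    P = mp w := by
  classical
  have h1 : hfin.toFinset.inf mp ≤ P := by
    have h2 : hfin.toFinset.inf mp ≤ (Ideal.span (Set.range f)).radical := by
      rw [← vanishingIdeal_zeroLocus_eq_radical (K := K)]
      intro g hg
      rw [mem_vanishingIdeal_iff]
      intro x hx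
      have hx' : x ∈ hfin.toFinset := by
        rw [Set.Finite.mem_toFinset]
        intro i
        have := (mem_zeroLocus_iff.1 hx) (f i) (Ideal.subset_span ⟨i, rfl⟩)
        simpa using this
      have h3 : g ∈ mp x := (Finset.inf_le hx' : hfin.toFinset.inf mp ≤ mp x) hg
      rw [RingHom.mem_ker] at h3
      simpa using h3
    refine h2.trans ?_
    rw [hP.radical_le_iff, Ideal.span_le]
    rintro _ ⟨i, rfl⟩; exact hf i
  obtain ⟨x, -, hx⟩ := hP.inf_le'.1 h1
  refine le_antisymm hw ?_
  have h4 : mp x = mp w := (inferInstance : (mp x).IsMaximal).eq_of_le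
    (inferInstance : (mp w).IsMaximal).ne_top (hx.trans hw)
  rw [← h4]; exact hx

/-- the deformation -/
noncomputable def dfm (d : σ → ℕ) (f : σ → MvPolynomial σ K) (i : σ) : MvPolynomial σ (Polynomial K) :=
  C Polynomial.X * X i ^ d i + C (1 - Polynomial.X) * map Polynomial.C (f i)

lemma sub_mem_X (h : MvPolynomial σ (Polynomial K)) :
    h - map Polynomial.C (map (Polynomial.evalRingHom 0) h) ∈
      Ideal.span {(C Polynomial.X : MvPolynomial σ (Polynomial K))} := by
  rw [← Ideal.Quotient.eq]
  have : Ideal.Quotient.mk (Ideal.span {(C Polynomial.X : MvPolynomial σ (Polynomial K))}) =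
      (Ideal.Quotient.mk (Ideal.span {(C Polynomial.X : MvPolynomial σ (Polynomial K))})).comp
        ((map Polynomial.C).comp (map (Polynomial.evalRingHom 0))) := by
    apply MvPolynomial.ringHom_ext
    · intro c
      rw [RingHom.comp_apply, Ideal.Quotient.eq]
      simp only [RingHom.comp_apply, map_C, ← C_sub]
      rw [Ideal.mem_span_singleton]
      refine map_dvd C ?_
      rw [Polynomial.X_dvd_iff]
      simp [Polynomial.coeff_zero_eq_eval_zero]
    · intro i; simp
  exact RingHom.congr_fun this h

lemma exists_prime {d : σ → ℕ} (f : σ → MvPolynomial σ K)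
    (hfin : {p | ∀ i, eval p (f i) = 0}.Finite) {w : σ → K} (hw : ∀ i, eval w (f i) = 0) :
    ∃ P : Ideal (MvPolynomial σ (Polynomial K)), P.IsPrime ∧ Ideal.span (Set.range (dfm d f)) ≤ P ∧
      P ≤ RingHom.ker (ev0 w) ∧ C Polynomial.X ∉ P := by
  classical
  have h0 : Ideal.span (((Finset.univ.image (dfm d f) : Finset _) : Set (MvPolynomial σ (Polynomial K)))) ≤ RingHom.ker (ev0 w) := by
    rw [Ideal.span_le]
    intro z hz
    obtain ⟨i, -, rfl⟩ := Finset.mem_image.1 (Finset.mem_coe.1 hz)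
    show dfm d f i ∈ RingHom.ker (ev0 w)
    rw [RingHom.mem_ker]
    have : (Polynomial.evalRingHom (0 : K)).comp Polynomial.C = RingHom.id K := by ext; simp
    simp [ev0, dfm, MvPolynomial.map_map, this, hw i]
  obtain ⟨P, hPm, hPw⟩ := Ideal.exists_minimalPrimes_le h0
  have hPp : P.IsPrime := hPm.1.1
  have hle : Ideal.span (Set.range (dfm d f)) ≤ P := by
    have := hPm.1.2
    rwa [Finset.coe_image, Finset.coe_univ, Set.image_univ] at this
  refine ⟨P, hPp, hle, hPw, fun hX => ?_⟩
  have hht := Ideal.height_le_card_of_mem_minimalPrimes_span_finset hPm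
  have hmp : P.comap (map Polynomial.C) = mp w := by
    refine prime_eq_mp f hfin (Ideal.comap_isPrime _ _) ?_ ?_
    · intro i
      rw [Ideal.mem_comap]
      have h1 : dfm d f i ∈ P := hle (Ideal.subset_span ⟨i, rfl⟩)
      have h2 : (map Polynomial.C (f i) : MvPolynomial σ (Polynomial K)) =
          dfm d f i - C Polynomial.X * (X i ^ d i - map Polynomial.C (f i)) := by
        rw [dfm, C_sub, C_1]; ring
      rw [h2]
      exact sub_mem h1 (Ideal.mul_mem_right _ _ hX)
    · intro g hg
      have h1 : ev0 w (map Polynomial.C g) = 0 := hPw hg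
      have : (Polynomial.evalRingHom (0 : K)).comp Polynomial.C = RingHom.id K := by ext; simp
      rw [RingHom.mem_ker]
      simpa [ev0, MvPolynomial.map_map, this] using h1
  have hPe : P = RingHom.ker (ev0 w) := by
    refine le_antisymm hPw fun h hh => ?_
    have h1 := sub_mem_X h
    have h2 : (Ideal.span {(C Polynomial.X : MvPolynomial σ (Polynomial K))}) ≤ P := by
      rw [Ideal.span_le]; simpa using hX
    have h3 : map (Polynomial.evalRingHom 0) h ∈ P.comap (map Polynomial.C) := by
      rw [hmp]; exact hh
    have h4 := add_mem (h2 h1) h3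
    rwa [sub_add_cancel] at h4
  rw [hPe, height_ev0] at hht
  have hc : (Finset.univ.image (dfm d f)).card ≤ Fintype.card σ := Finset.card_image_le
  have : Fintype.card σ + 1 ≤ (Finset.univ.image (dfm d f)).card := by exact_mod_cast hht
  omega

open Classical in
lemma exists_interp (S : Finset (σ → K)) : ∃ e : (σ → K) → MvPolynomial σ K,
    ∀ w ∈ S, ∀ w' ∈ S, eval w' (e w) = if w = w' then 1 else 0 := by
  classical
  have h1 : ∀ w w' : σ → K, ∃ g : MvPolynomial σ K, eval w g = 1 ∧ (w ≠ w' → eval w' g = 0) := by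
    intro w w'
    by_cases h : w = w'
    · exact ⟨1, by simp, fun h' => absurd h h'⟩
    · obtain ⟨i, hi⟩ := Function.ne_iff.1 h
      have hne : w i - w' i ≠ 0 := sub_ne_zero.2 hi
      exact ⟨C (w i - w' i)⁻¹ * (X i - C (w' i)), by simp [hne], fun _ => by simp⟩
  choose g hg1 hg2 using h1
  refine ⟨fun w => ∏ w' ∈ S.erase w, g w w', fun w hw w' hw' => ?_⟩
  rw [map_prod]
  split_ifs with h
  · subst h; exact Finset.prod_eq_one fun x _ => hg1 _ _
  · exact Finset.prod_eq_zero (Finset.mem_erase.2 ⟨Ne.symm h, hw'⟩) (hg2 _ _ h)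

attribute [local instance] MvPolynomial.algebraMvPolynomial in
theorem bezout_aux (L : Type) [Field L] [Algebra (Polynomial K) L] [IsFractionRing (Polynomial K) L]
    {d : σ → ℕ} (hd : ∀ i, 0 < d i) (f : σ → MvPolynomial σ K)
    (hf : ∀ i, (f i).totalDegree ≤ d i)
    (hfin : {p | ∀ i, eval p (f i) = 0}.Finite) :
    {p | ∀ i, eval p (f i) = 0}.ncard ≤ ∏ i, d i := by
  classical
  set S := hfin.toFinset with hS
  have hmem : ∀ w ∈ S, ∀ i, eval w (f i) = 0 := fun w hw => (Set.Finite.mem_toFinset hfin).1 hw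
  rw [Set.ncard_eq_toFinset_card _ hfin]
  obtain ⟨e, he⟩ := exists_interp S
  have hprime : ∀ w : S, _ := fun w => exists_prime (d := d) f hfin (hmem w.1 w.2)
  choose P hPp hPg hPw hPX using hprime
  have hinj : Function.Injective (algebraMap (Polynomial K) L) := IsFractionRing.injective (Polynomial K) L
  let G : σ → MvPolynomial σ L := fun i => map (algebraMap (Polynomial K) L) (dfm d f i)
  have hG : ∀ i, (G i).totalDegree ≤ d i := by
    intro i
    refine (Finset.sup_mono (support_map_subset _ _)).trans ?_
    refine (totalDegree_add _ _).trans (max_le ?_ ?_)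
    · refine (totalDegree_mul _ _).trans ?_
      rw [totalDegree_C, zero_add]
      exact (totalDegree_pow _ _).trans (by simp)
    · refine (totalDegree_mul _ _).trans ?_
      rw [totalDegree_C, zero_add]
      exact (Finset.sup_mono (support_map_subset _ _)).trans (hf i)
  have hu : IsUnit (gdet d G) := by
    rw [← map_gdet (algebraMap (Polynomial K) L), isUnit_iff_ne_zero, Ne, map_eq_zero_iff (algebraMap (Polynomial K) L) hinj]
    intro h0
    have h1 := congrArg (Polynomial.evalRingHom (1 : K)) h0
    rw [map_gdet, map_zero] at h1
    have h2 : (fun i => map (Polynomial.evalRingHom (1 : K)) (dfm d f i)) = fun i => X i ^ d i := by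
      ext1 i; simp [dfm]
    rw [h2, gdet_pow] at h1
    exact one_ne_zero h1
  -- key: elements of `K[X]` outside zero avoid the primes
  have hPC : ∀ (w : S) (b : Polynomial K), b ≠ 0 → (C b : MvPolynomial σ (Polynomial K)) ∉ P w := by
    intro w b hb hmemb
    obtain ⟨b', hb', hnd⟩ := Polynomial.exists_eq_pow_rootMultiplicity_mul_and_not_dvd b hb 0
    rw [Polynomial.C_0, sub_zero] at hb' hnd
    rw [hb', C_mul, C_pow] at hmemb
    rcases (hPp w).mem_or_mem hmemb with h | h
    · exact hPX w ((hPp w).mem_of_pow_mem _ h)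
    · have h2 : ev0 w.1 (C b') = 0 := hPw w h
      rw [Polynomial.X_dvd_iff, Polynomial.coeff_zero_eq_eval_zero] at hnd
      apply hnd
      simpa [ev0] using h2
  have hdiv : ∀ (a : ℕ) (c : S → Polynomial K),
      (∀ w' : S, ∑ w : S, C (c w) * map Polynomial.C (e w) ∈ P w') → ∀ w, Polynomial.X ^ a ∣ c w := by
    intro a
    induction a with
    | zero => intro c _ w; simp
    | succ a ih =>
      intro c hc
      have h1 : ∀ w, Polynomial.X ∣ c w := by
        intro w'
        rw [Polynomial.X_dvd_iff, Polynomial.coeff_zero_eq_eval_zero]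
        have h2 : ev0 w'.1 (∑ w : S, C (c w) * map Polynomial.C (e w)) = 0 := hPw w' (hc w')
        have : (Polynomial.evalRingHom (0 : K)).comp Polynomial.C = RingHom.id K := by ext; simp
        have h3 : ∀ w : S, ev0 w'.1 (C (c w) * map Polynomial.C (e w)) =
            if w = w' then Polynomial.eval 0 (c w) else 0 := by
          intro w
          have h7 := he w.1 w.2 w'.1 w'.2
          simp only [ev0, RingHom.comp_apply, map_mul, MvPolynomial.map_map, this, map_C, eval_C, h7,
            MvPolynomial.map_id, Polynomial.coe_evalRingHom]
          by_cases hww : w = w'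
          · rw [if_pos hww, if_pos (congrArg Subtype.val hww), mul_one]
          · rw [if_neg hww, if_neg (fun h => hww (Subtype.ext h)), mul_zero]
        rw [map_sum, Finset.sum_congr rfl fun w _ => h3 w] at h2
        simpa using h2
      choose c' hc' using h1
      have h4 := ih c' (by
        intro w'
        have h5 := hc w'
        have h6 : ∑ w : S, C (c w) * map Polynomial.C (e w) =
            C Polynomial.X * ∑ w : S, C (c' w) * map Polynomial.C (e w) := by
          rw [Finset.mul_sum]
          refine Finset.sum_congr rfl fun w _ => ?_
          rw [hc' w, C_mul, mul_assoc]
        rw [h6] at h5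
        exact ((hPp w').mem_or_mem h5).resolve_left (hPX w'))
      intro w
      rw [hc' w, pow_succ']
      exact mul_dvd_mul_left _ (h4 w)
  let v : S → MvPolynomial σ L ⧸ Ideal.span (Set.range G) := fun w =>
    Ideal.Quotient.mk _ (map (algebraMap (Polynomial K) L) (map Polynomial.C (e w)))
  have hv : LinearIndependent L v := by
    rw [← LinearIndependent.iff_fractionRing (Polynomial K) L, Fintype.linearIndependent_iff]
    intro c hc
    have h1 : ∑ w : S, c w • v w = Ideal.Quotient.mk (Ideal.span (Set.range G))
        (map (algebraMap (Polynomial K) L) (∑ w : S, C (c w) * map Polynomial.C (e w))) := by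
      rw [map_sum, map_sum]
      refine Finset.sum_congr rfl fun w _ => ?_
      rw [map_mul, map_C, map_mul, ← IsScalarTower.algebraMap_smul L (c w) (v w)]
      exact Algebra.smul_def (algebraMap (Polynomial K) L (c w)) (v w)
    rw [h1, Ideal.Quotient.eq_zero_iff_mem] at hc
    have h2 : Ideal.span (Set.range G) = Ideal.map (algebraMap (MvPolynomial σ (Polynomial K)) (MvPolynomial σ L)) (Ideal.span (Set.range (dfm d f))) := by
      rw [Ideal.map_span, ← Set.range_comp]; rfl
    rw [h2, IsLocalization.mem_map_algebraMap_iff ((nonZeroDivisors (Polynomial K)).map (C : _ →+* MvPolynomial σ (Polynomial K)))] at hc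
    obtain ⟨⟨x, ⟨_, ⟨b, hb, rfl⟩⟩⟩, hx⟩ := hc
    have hx' : map (algebraMap (Polynomial K) L) ((∑ w : S, C (c w) * map Polynomial.C (e w)) * C b) = map (algebraMap (Polynomial K) L) x.1 := by
      rw [map_mul]; exact hx
    have h3 := map_injective (algebraMap (Polynomial K) L) hinj hx'
    have h4 : ∀ w' : S, ∑ w : S, C (c w) * map Polynomial.C (e w) ∈ P w' := by
      intro w'
      have h5 := hPg w' x.2
      rw [← h3] at h5
      exact ((hPp w').mem_or_mem h5).resolve_right (hPC w' b (nonZeroDivisors.ne_zero hb))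
    intro w
    ext m
    have := hdiv (m + 1) c h4 w
    rw [Polynomial.X_pow_dvd_iff] at this
    simpa using this m (Nat.lt_succ_self m)
  have := finrank_quot_le hd hG hu v hv
  simpa using this

theorem bezout {d : σ → ℕ} (hd : ∀ i, 0 < d i) (f : σ → MvPolynomial σ K)
    (hf : ∀ i, (f i).totalDegree ≤ d i)
    (hfin : {p | ∀ i, eval p (f i) = 0}.Finite) :
    {p | ∀ i, eval p (f i) = 0}.ncard ≤ ∏ i, d i :=
  bezout_aux (FractionRing (Polynomial K)) hd f hf hfin

end Bezout


section Affine
variable {σ ι : Type} [Fintype σ] [DecidableEq σ] [Fintype ι] [DecidableEq ι] {K : Type} [Field K] [IsAlgClosed K]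

lemma totalDegree_aeval_linear {R : Type} [CommRing R] (l : σ → MvPolynomial ι R)
    (hl : ∀ a, (l a).totalDegree ≤ 1) (f : MvPolynomial σ R) :
    (aeval l f).totalDegree ≤ f.totalDegree := by
  rw [aeval_def, eval₂_eq]
  refine totalDegree_finsetSum_le fun m hm => ?_
  refine (totalDegree_mul _ _).trans ?_
  rw [algebraMap_eq, totalDegree_C, zero_add]
  refine (totalDegree_finsetProd _ _).trans ?_
  have h1 : ∀ i ∈ m.support, (l i ^ m i).totalDegree ≤ m i := fun i _ =>
    (totalDegree_pow _ _).trans ((Nat.mul_le_mul_left _ (hl i)).trans (by simp))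
  exact (Finset.sum_le_sum h1).trans (le_totalDegree hm)

theorem bezout_affine {d : ι → ℕ} (hd : ∀ i, 0 < d i) (f : ι → MvPolynomial σ K)
    (hf : ∀ i, (f i).totalDegree ≤ d i) (L : AffineSubspace K (σ → K))
    (hL : Module.finrank K L.direction = Fintype.card ι)
    (hfin : ({p | ∀ i, eval p (f i) = 0} ∩ (L : Set (σ → K))).Finite) :
    ({p | ∀ i, eval p (f i) = 0} ∩ (L : Set (σ → K))).ncard ≤ ∏ i, d i := by
  classical
  rcases Set.eq_empty_or_nonempty (L : Set (σ → K)) with hE | ⟨p0, hp0⟩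
  · rw [hE]; simp
  let b : Module.Basis ι K L.direction := (Module.finBasis K L.direction).reindex
    (Fintype.equivOfCardEq (by simp [hL]))
  let φ : (ι → K) → (σ → K) := fun t => ((b.equivFun.symm t : L.direction) : σ → K) + p0
  have hφL : ∀ t, φ t ∈ L := fun t => AffineSubspace.vadd_mem_of_mem_direction (b.equivFun.symm t).2 hp0
  have hφi : Function.Injective φ := by
    intro t t' h
    exact b.equivFun.symm.injective (Subtype.ext (add_right_cancel h))
  have hφs : ∀ p ∈ L, ∃ t, φ t = p := by
    intro p hp
    refine ⟨b.equivFun ⟨p - p0, AffineSubspace.vsub_mem_direction hp hp0⟩, ?_⟩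
    show ((b.equivFun.symm (b.equivFun _) : L.direction) : σ → K) + p0 = p
    rw [LinearEquiv.symm_apply_apply]; simp
  let l : σ → MvPolynomial ι K := fun a => (∑ j, C ((b j : σ → K) a) * X j) + C (p0 a)
  have hl : ∀ a, (l a).totalDegree ≤ 1 := by
    intro a
    refine (totalDegree_add _ _).trans (max_le ?_ (by simp))
    refine totalDegree_finsetSum_le fun j _ => (totalDegree_mul _ _).trans ?_
    simp
  have hev : ∀ t (g : MvPolynomial σ K), eval t (aeval l g) = eval (φ t) g := by
    intro t g
    have h1 : (eval t).comp (aeval l : MvPolynomial σ K →ₐ[K] _).toRingHom = eval (φ t) := by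
      apply MvPolynomial.ringHom_ext
      · intro c; simp
      · intro a
        simp [l, φ, Module.Basis.equivFun_symm_apply, mul_comm]
    exact RingHom.congr_fun h1 g
  have hset : {p | ∀ i, eval p (f i) = 0} ∩ (L : Set (σ → K)) =
      φ '' {t | ∀ i, eval t (aeval l (f i)) = 0} := by
    ext p
    constructor
    · rintro ⟨h1, h2⟩
      obtain ⟨t, rfl⟩ := hφs p h2
      exact ⟨t, fun i => by rw [hev]; exact h1 i, rfl⟩
    · rintro ⟨t, ht, rfl⟩
      exact ⟨fun i => by rw [← hev]; exact ht i, hφL t⟩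
  rw [hset] at hfin ⊢
  rw [Set.ncard_image_of_injective _ hφi]
  exact bezout hd _ (fun i => (totalDegree_aeval_linear l hl _).trans (hf i))
    (Set.Finite.of_finite_image hfin hφi.injOn)

end Affine


section Main
variable {K : Type} [Field K] [IsAlgClosed K]

lemma totalDegree_pderiv_le {σ : Type} [DecidableEq σ] (j : σ) (p : MvPolynomial σ K) :
    (pderiv j p).totalDegree ≤ p.totalDegree - 1 := by
  conv_lhs => rw [p.as_sum]
  rw [map_sum]
  refine totalDegree_finsetSum_le fun s hs => ?_
  rw [pderiv_monomial]
  by_cases h : s j = 0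
  · simp [h]
  · refine (totalDegree_monomial_le _ _).trans ?_
    have h1 : s.degree ≤ p.totalDegree := le_totalDegree hs
    have h2 : (s - Finsupp.single j 1) + Finsupp.single j 1 = s :=
      tsub_add_cancel_of_le (by simpa using Nat.one_le_iff_ne_zero.2 h)
    have h3 := congrArg Finsupp.degree h2
    rw [map_add, Finsupp.degree_single] at h3
    show (s - Finsupp.single j 1).degree ≤ _
    omega

lemma zeroLocus_range {n : ℕ} {ι : Type} (F : ι → MvPolynomial (Fin n) K) :
    zeroLocus K (Ideal.span (Set.range F)) = {p | ∀ i, eval p (F i) = 0} := by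
  rw [zeroLocus_span]
  ext p
  simp [aeval_eq_eval]

lemma varDim_complete {n : ℕ} {ι : Type} [Fintype ι] (F : ι → MvPolynomial (Fin n) K)
    (hne : ∃ p, ∀ i, eval p (F i) = 0)
    (hJ : ∀ p, (∀ i, eval p (F i) = 0) →
      LinearIndependent K (fun i : ι => fun a => eval p (pderiv a (F i)))) :
    varDim {p | ∀ i, eval p (F i) = 0} = n - Fintype.card ι ∧ Fintype.card ι ≤ n := by
  obtain ⟨h1, h2⟩ := dim_complete F hne hJ
  rw [Fintype.card_fin] at h1 h2
  refine ⟨?_, h2⟩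
  rw [← zeroLocus_range, varDim, vanishingIdeal_zeroLocus_eq_radical, ringKrullDim_quotient,
    PrimeSpectrum.zeroLocus_radical, ← ringKrullDim_quotient, h1]
  rfl

variable {n r : ℕ} (F : Fin r → MvPolynomial (Fin n) K)

/-- the equations of the tangent bundle -/
noncomputable def TF : Fin r ⊕ Fin r → MvPolynomial (Fin (n + n)) K :=
  Sum.elim (fun i => rename (Fin.castAdd n) (F i))
    (fun i => ∑ j, rename (Fin.castAdd n) (pderiv j (F i)) * X (Fin.natAdd n j))

lemma eval_rename_fst (z : Fin (n + n) → K) (p : MvPolynomial (Fin n) K) :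
    eval z (rename (Fin.castAdd n) p) = eval (fstProj z) p := by
  rw [eval_rename]; rfl

lemma TF_degree {k : Fin r → ℕ} (hk : ∀ i, 0 < k i) (hF : ∀ i, (F i).totalDegree ≤ k i) (s : Fin r ⊕ Fin r) :
    (TF F s).totalDegree ≤ Sum.elim k k s := by
  rcases s with i | i
  · exact (totalDegree_rename_le _ _).trans (hF i)
  · rw [TF, Sum.elim_inr]
    refine totalDegree_finsetSum_le fun j _ => ?_
    refine (totalDegree_mul _ _).trans ?_
    have h0 : (X (Fin.natAdd n j) : MvPolynomial (Fin (n + n)) K).totalDegree = 1 := totalDegree_X _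
    rw [h0]
    have h1 := (totalDegree_rename_le (Fin.castAdd n) (pderiv j (F i))).trans
      (totalDegree_pderiv_le j (F i))
    have h2 := hF i
    have h3 := hk i
    simp only [Sum.elim_inr]
    omega

lemma pderiv_rename_snd (j : Fin n) (p : MvPolynomial (Fin n) K) :
    pderiv (Fin.natAdd n j) (rename (Fin.castAdd n) p) = 0 := by
  apply pderiv_eq_zero_of_notMem_vars
  intro h
  have h1 := vars_rename (Fin.castAdd n) p h
  obtain ⟨i, -, hi⟩ := Finset.mem_image.1 h1
  have := congrArg Fin.val hi
  simp at this
  omega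

lemma TF_jac (hJ : ∀ p, (∀ i, eval p (F i) = 0) →
      LinearIndependent K (fun i => fun a => eval p (pderiv a (F i))))
    (z : Fin (n + n) → K) (hz : ∀ s, eval z (TF F s) = 0) :
    LinearIndependent K (fun s => fun a => eval z (pderiv a (TF F s))) := by
  have hx : ∀ i, eval (fstProj z) (F i) = 0 := fun i => by
    have := hz (Sum.inl i)
    rwa [TF, Sum.elim_inl, eval_rename_fst] at this
  have hli := hJ _ hx
  rw [Fintype.linearIndependent_iff] at hli ⊢
  intro c hc
  have e1 : ∀ (i : Fin r) (j : Fin n), eval z (pderiv (Fin.natAdd n j) (TF F (Sum.inl i))) = 0 := by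
    intro i j
    rw [TF, Sum.elim_inl, pderiv_rename_snd, map_zero]
  have e2 : ∀ (i : Fin r) (j : Fin n), eval z (pderiv (Fin.castAdd n j) (TF F (Sum.inl i))) =
      eval (fstProj z) (pderiv j (F i)) := by
    intro i j
    rw [TF, Sum.elim_inl, pderiv_rename (Fin.castAdd_injective n n), eval_rename_fst]
  have e3 : ∀ (i : Fin r) (j : Fin n), eval z (pderiv (Fin.natAdd n j) (TF F (Sum.inr i))) =
      eval (fstProj z) (pderiv j (F i)) := by
    intro i j
    rw [TF, Sum.elim_inr, map_sum, map_sum, Finset.sum_eq_single j]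
    · rw [pderiv_mul, pderiv_rename_snd, pderiv_X_self, zero_mul, zero_add, mul_one, eval_rename_fst]
    · intro b _ hb
      rw [pderiv_mul, pderiv_rename_snd, pderiv_X_of_ne, zero_mul, zero_add, mul_zero, map_zero]
      exact fun h => hb (Fin.natAdd_injective n n h)
    · simp
  have h1 : ∀ i, c (Sum.inr i) = 0 := by
    apply hli (fun i => c (Sum.inr i))
    ext j
    have := congrFun hc (Fin.natAdd n j)
    simpa [Fintype.sum_sum_type, Finset.sum_apply, e1, e3, -Fin.natAdd_eq_addNat] using this
  have h2 : ∀ i, c (Sum.inl i) = 0 := by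
    apply hli (fun i => c (Sum.inl i))
    ext j
    have := congrFun hc (Fin.castAdd n j)
    simpa [Fintype.sum_sum_type, Finset.sum_apply, h1, e2] using this
  rintro (i | i)
  · exact h2 i
  · exact h1 i

lemma tangentSpace_eq (hpr : (Ideal.span (Set.range F)).IsPrime) (p : Fin n → K)
    (hp : ∀ i, eval p (F i) = 0) :
    tangentSpaceAt {p | ∀ i, eval p (F i) = 0} p =
      {y | ∀ i, ∑ j, eval p (pderiv j (F i)) * y j = 0} := by
  rw [← zeroLocus_range, tangentSpaceAt, IsPrime.vanishingIdeal_zeroLocus]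
  ext y
  constructor
  · intro h i; exact h _ (Ideal.subset_span ⟨i, rfl⟩)
  · intro h f hf
    obtain ⟨c, rfl⟩ := Ideal.mem_span_range_iff_exists_fun.1 hf
    have : ∀ j, eval p (pderiv j (∑ i, c i * F i)) = ∑ i, eval p (c i) * eval p (pderiv j (F i)) := by
      intro j
      rw [map_sum, map_sum]
      refine Finset.sum_congr rfl fun i _ => ?_
      rw [pderiv_mul, map_add, map_mul, map_mul, hp i]; ring
    simp only [this, Finset.sum_mul]
    rw [Finset.sum_comm]
    refine Finset.sum_eq_zero fun i _ => ?_
    have h2 := h i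
    calc _ = eval p (c i) * ∑ j, eval p (pderiv j (F i)) * y j := by
          rw [Finset.mul_sum]; exact Finset.sum_congr rfl fun j _ => by ring
      _ = 0 := by rw [h2, mul_zero]

lemma tangentDim (hpr : (Ideal.span (Set.range F)).IsPrime) (p : Fin n → K)
    (hp : ∀ i, eval p (F i) = 0)
    (hJ : LinearIndependent K (fun i => fun a => eval p (pderiv a (F i)))) :
    tangentDimAt {p | ∀ i, eval p (F i) = 0} p = n - r := by
  rw [tangentDimAt, tangentSpace_eq F hpr p hp]
  let M : Matrix (Fin r) (Fin n) K := Matrix.of fun i a => eval p (pderiv a (F i))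
  have h1 : {y : Fin n → K | ∀ i, ∑ j, eval p (pderiv j (F i)) * y j = 0} =
      (LinearMap.ker M.mulVecLin : Submodule K (Fin n → K)) := by
    ext y
    rw [SetLike.mem_coe, LinearMap.mem_ker, funext_iff]
    rfl
  rw [h1, Submodule.span_eq]
  have h2 := LinearMap.finrank_range_add_finrank_ker M.mulVecLin
  have h3 : M.rank = r := by
    have := LinearIndependent.rank_matrix (M := M) hJ
    simpa using this
  rw [Matrix.rank] at h3
  simp at h2
  omega

lemma tangentBundle_eq (hpr : (Ideal.span (Set.range F)).IsPrime) :
    tangentBundle {p | ∀ i, eval p (F i) = 0} = {z | ∀ s, eval z (TF F s) = 0} := by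
  ext z
  have e : ∀ i, eval z (TF F (Sum.inr i)) = ∑ j, eval (fstProj z) (pderiv j (F i)) * sndProj z j := by
    intro i
    rw [TF, Sum.elim_inr, map_sum]
    refine Finset.sum_congr rfl fun j _ => ?_
    rw [map_mul, eval_rename_fst, eval_X]; rfl
  constructor
  · rintro ⟨h1, h2⟩
    rw [tangentSpace_eq F hpr _ h1] at h2
    rintro (i | i)
    · rw [TF, Sum.elim_inl, eval_rename_fst]; exact h1 i
    · rw [e]; exact h2 i
  · intro h
    have h1 : ∀ i, eval (fstProj z) (F i) = 0 := fun i => by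
      have := h (Sum.inl i)
      rwa [TF, Sum.elim_inl, eval_rename_fst] at this
    refine ⟨h1, ?_⟩
    rw [tangentSpace_eq F hpr _ h1]
    intro i
    rw [← e]; exact h _

theorem main_geom {k : Fin r → ℕ} (hk : ∀ i, 0 < k i) (hF : ∀ i, (F i).totalDegree ≤ k i)
    (hpr : (Ideal.span (Set.range F)).IsPrime)
    (hJ : ∀ p, (∀ i, eval p (F i) = 0) →
      LinearIndependent K (fun i => fun a => eval p (pderiv a (F i))))
    (L : AffineSubspace K (Fin n → K)) (hL : Module.finrank K L.direction = r)
    (hLf : ({p | ∀ i, eval p (F i) = 0} ∩ (L : Set (Fin n → K))).Finite)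
    (hLc : ∏ i, k i ≤ ({p | ∀ i, eval p (F i) = 0} ∩ (L : Set (Fin n → K))).ncard) :
    IsIrreducibleVariety (zeroLocus K (Ideal.span (Set.range F))) ∧
          IsSmoothVariety (zeroLocus K (Ideal.span (Set.range F))) ∧
          geomDegree (tangentBundle (zeroLocus K (Ideal.span (Set.range F)))) ≤
            (geomDegree (zeroLocus K (Ideal.span (Set.range F)))) ^ 2 := by
  have hD : 0 < ∏ i, k i := Finset.prod_pos fun i _ => hk i
  obtain ⟨p0, hp0, -⟩ := (Set.ncard_pos hLf).1 (hD.trans_le hLc)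
  have hne : ∃ p, ∀ i, eval p (F i) = 0 := ⟨p0, hp0⟩
  obtain ⟨hdim, hrn⟩ := varDim_complete F hne hJ
  rw [Fintype.card_fin] at hdim hrn
  refine ⟨⟨⟨_, rfl⟩, by rw [IsPrime.vanishingIdeal_zeroLocus]; exact hpr⟩, ?_, ?_⟩
  · rw [zeroLocus_range]
    intro p hp
    rw [IsSmoothAt, tangentDim F hpr p hp (hJ p hp), hdim]
  · rw [zeroLocus_range, tangentBundle_eq F hpr]
    have hneT : ∃ z, ∀ s, eval z (TF F s) = 0 := by
      refine ⟨Fin.append p0 0, ?_⟩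
      have hfst : fstProj (Fin.append p0 (0 : Fin n → K)) = p0 := by ext i; simp [fstProj]
      rintro (i | i)
      · rw [TF, Sum.elim_inl, eval_rename_fst, hfst]; exact hp0 i
      · rw [TF, Sum.elim_inr, map_sum]
        refine Finset.sum_eq_zero fun j _ => ?_
        rw [map_mul, eval_X, Fin.append_right, Pi.zero_apply, mul_zero]
    obtain ⟨hdimT, hrT⟩ := varDim_complete (TF F) hneT (TF_jac F hJ)
    rw [Fintype.card_sum, Fintype.card_fin] at hdimT hrT
    have h1 : geomDegree {z | ∀ s, eval z (TF F s) = 0} ≤ (∏ i, k i) ^ 2 := by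
      refine csSup_le' ?_
      rintro m ⟨L', hL', hfin, rfl⟩
      rw [hdimT] at hL'
      have hb := bezout_affine (d := Sum.elim k k) (by rintro (i | i) <;> exact hk i) (TF F)
        (TF_degree F hk hF) L' (by rw [hL', Fintype.card_sum, Fintype.card_fin]; omega) hfin
      rw [Fintype.prod_sum_type] at hb
      simpa [sq] using hb
    have h2 : ∏ i, k i ≤ geomDegree {p | ∀ i, eval p (F i) = 0} := by
      refine hLc.trans (le_csSup ⟨∏ i, k i, ?_⟩ ⟨L, by rw [hL, hdim]; omega, hLf, rfl⟩)
      rintro m ⟨L', hL', hfin, rfl⟩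
      rw [hdim] at hL'
      exact bezout_affine hk F hF L' (by rw [hL', Fintype.card_fin]; omega) hfin
    exact h1.trans (Nat.pow_le_pow_left h2 2)

end Main


section Final
variable {K : Type} [Field K] [IsAlgClosed K] [CharZero K]

lemma main_transport {n r m : ℕ} (ε : Fin r ⊕ Fin m ≃ Fin n) (o : Fin m) {k : Fin r → ℕ} (hk : ∀ i, 0 < k i)
    (F : Fin r → MvPolynomial (Fin n) K)
    (hF : ∀ i, (rename ε.symm (F i)).totalDegree ≤ k i)
    (hu : IsUnit (qdet k (fun i => rename ε.symm (F i))))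
    (hirr : Irreducible (chi hk hF hu o)) :
    (Ideal.span (Set.range F)).IsPrime ∧ ∃ L : AffineSubspace K (Fin n → K),
      Module.finrank K L.direction = r ∧
      ({p | ∀ i, eval p (F i) = 0} ∩ (L : Set (Fin n → K))).Finite ∧
      ∏ i, k i ≤ ({p | ∀ i, eval p (F i) = 0} ∩ (L : Set (Fin n → K))).ncard := by
  classical
  have hev : ∀ (p : Fin r ⊕ Fin m → K) i, eval p (rename ε.symm (F i)) = eval (p ∘ ε.symm) (F i) := by
    intro p i; rw [eval_rename]
  refine ⟨?_, ?_⟩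
  · have hp := span_prime hk hF hu o hirr
    have h1 : Ideal.span (Set.range F) = Ideal.map (renameEquiv K ε).toRingEquiv
        (Ideal.span (Set.range fun i => rename ε.symm (F i))) := by
      rw [Ideal.map_span, ← Set.range_comp]
      congr 2
      ext1 i
      show F i = rename ε (rename ε.symm (F i))
      rw [rename_rename]; simp
    rw [h1]
    exact Ideal.map_isPrime_of_equiv _
  · obtain ⟨e, S, hc, hS⟩ := slice_points hk hF hu o hirr
    have hfin := slice_finite hk hF hu e
    let ρ : (Fin n → K) →ₗ[K] (Fin m → K) := LinearMap.funLeft K K (fun j => ε (Sum.inr j))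
    have hinj : Function.Injective (fun j => ε (Sum.inr j)) := fun a b h => by
      simpa using h
    have hρ : Function.Surjective ρ := LinearMap.funLeft_surjective_of_injective K K _ hinj
    let p1 : Fin n → K := Sum.elim 0 e ∘ ε.symm
    have hp1 : ρ p1 = e := by
      ext j; simp [ρ, p1, LinearMap.funLeft_apply]
    let L := AffineSubspace.mk' p1 (LinearMap.ker ρ)
    have hLm : ∀ x, x ∈ L ↔ ∀ j, x (ε (Sum.inr j)) = e j := by
      intro x
      rw [AffineSubspace.mem_mk', LinearMap.mem_ker, vsub_eq_sub, map_sub, hp1, sub_eq_zero, funext_iff]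
      rfl
    have hset : {p | ∀ i, eval p (F i) = 0} ∩ (L : Set (Fin n → K)) =
        (fun p : Fin r ⊕ Fin m → K => p ∘ ε.symm) ''
        {p | (∀ i, eval p (rename ε.symm (F i)) = 0) ∧ ∀ j, p (Sum.inr j) = e j} := by
      ext x
      constructor
      · rintro ⟨h1, h2⟩
        have h3 : (x ∘ ε) ∘ ε.symm = x := by ext a; simp
        refine ⟨x ∘ ε, ⟨fun i => ?_, (hLm x).1 h2⟩, h3⟩
        rw [hev, h3]; exact h1 i
      · rintro ⟨p, ⟨h1, h2⟩, rfl⟩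
        refine ⟨fun i => ?_, (hLm _).2 fun j => ?_⟩
        · show eval (p ∘ ε.symm) (F i) = 0
          rw [← hev]; exact h1 i
        · simpa using h2 j
    have hpi : Function.Injective (fun p : Fin r ⊕ Fin m → K => p ∘ ε.symm) :=
      ε.symm.surjective.injective_comp_right
    refine ⟨L, ?_, ?_, ?_⟩
    · rw [AffineSubspace.direction_mk']
      have h1 := LinearMap.finrank_range_add_finrank_ker ρ
      rw [LinearMap.range_eq_top.2 hρ, finrank_top] at h1
      have h2 := Fintype.card_congr ε
      simp at h1 h2
      omega
    · rw [hset]; exact hfin.image _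
    · rw [hset, Set.ncard_image_of_injective _ hpi, ← hc, ← Set.ncard_coe_finset]
      exact Set.ncard_le_ncard (fun p hp => hS p hp) hfin

lemma main_open {n r : ℕ} (hrn : r < n) (k : Fin r → ℕ) (hk : ∀ i, 0 < k i) :
    ∃ q : MvPolynomial (CIdx (Fin n) k) K, q ≠ 0 ∧ ∀ F : Fin r → MvPolynomial (Fin n) K,
      (∀ i, (F i).totalDegree ≤ k i) → eval (cf k F) q ≠ 0 →
          IsIrreducibleVariety (zeroLocus K (Ideal.span (Set.range F))) ∧
          IsSmoothVariety (zeroLocus K (Ideal.span (Set.range F))) ∧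
          geomDegree (tangentBundle (zeroLocus K (Ideal.span (Set.range F)))) ≤
            (geomDegree (zeroLocus K (Ideal.span (Set.range F)))) ^ 2 := by
  classical
  obtain ⟨m, rfl⟩ : ∃ m, n = r + (m + 1) := ⟨n - r - 1, by omega⟩
  let ε : Fin r ⊕ Fin (m + 1) ≃ Fin (r + (m + 1)) := finSumFinEquiv
  obtain ⟨q1, hq1, h1⟩ := open_good (K := K) (k := k) hk (0 : Fin (m + 1))
  obtain ⟨q2, hq2, h2⟩ := open_smooth (σ := Fin (r + (m + 1))) (K := K) (k := k) hk
  have hdeg : ∀ α : Fin r ⊕ Fin (m + 1) →₀ ℕ, (α.mapDomain ε).degree = α.degree := by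
    intro α
    exact Finsupp.degree_mapDomain _ _
  let φ : CIdx (Fin r ⊕ Fin (m + 1)) k → CIdx (Fin (r + (m + 1))) k := fun v =>
    ⟨v.1, ⟨v.2.1.mapDomain ε, by rw [hdeg]; exact v.2.2⟩⟩
  have hφ : Function.Injective φ := by
    rintro ⟨i, a, ha⟩ ⟨j, b, hb⟩ h
    obtain ⟨h3, h4⟩ := Sigma.mk.inj_iff.1 h
    simp only at h3
    subst h3
    have h5 := congrArg Subtype.val (eq_of_heq h4)
    have h6 : a = b := Finsupp.mapDomain_injective ε.injective h5
    subst h6; rfl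
  refine ⟨rename φ q1 * q2, mul_ne_zero ?_ hq2, fun F hF hne => ?_⟩
  · rwa [Ne, map_eq_zero_iff _ (rename_injective φ hφ)]
  · rw [map_mul] at hne
    have hn1 := left_ne_zero_of_mul hne
    have hn2 := right_ne_zero_of_mul hne
    have hF' : ∀ i, (rename ε.symm (F i)).totalDegree ≤ k i := fun i =>
      (totalDegree_rename_le _ _).trans (hF i)
    have hcf : cf k F ∘ φ = cf k (fun i => rename ε.symm (F i)) := by
      ext v
      show coeff (v.2.1.mapDomain ε) (F v.1) = coeff v.2.1 (rename ε.symm (F v.1))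
      rw [← coeff_rename_mapDomain ε ε.injective, rename_rename]
      simp
    rw [eval_rename, hcf] at hn1
    obtain ⟨hu, hirr⟩ := h1 _ hF' hn1
    obtain ⟨hpr, L, hL1, hL2, hL3⟩ := main_transport ε 0 hk F hF' hu hirr
    exact main_geom F hk hF hpr (h2 F hF hn2) L hL1 hL2 hL3

end Final

/-- For generic polynomials `f₁, …, f_r` of degrees at most `k₁, …, k_r` (genericity
expressed by a nonzero polynomial condition on the coefficient vectors, satisfied by at
least one tuple), the variety `V_F = V(f₁, …, f_r) ⊆ A^n` is smooth and irreducible and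
satisfies `deg(T V_F) ≤ deg(V_F)²`. -/
theorem degree_tangentBundle_generic_complete_intersection {K : Type} [Field K]
    [IsAlgClosed K] [CharZero K] {n r : ℕ} (hrn : r < n) (k : Fin r → ℕ)
    (hk : ∀ i, 0 < k i) :
    ∃ Q : MvPolynomial (Fin r × (Fin n →₀ ℕ)) K, Q ≠ 0 ∧
      (∃ F₀ : Fin r → MvPolynomial (Fin n) K, (∀ i, (F₀ i).totalDegree ≤ k i) ∧
        eval (fun v => coeff v.2 (F₀ v.1)) Q ≠ 0) ∧
      ∀ F : Fin r → MvPolynomial (Fin n) K, (∀ i, (F i).totalDegree ≤ k i) →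
        eval (fun v => coeff v.2 (F v.1)) Q ≠ 0 →
          IsIrreducibleVariety (zeroLocus K (Ideal.span (Set.range F))) ∧
          IsSmoothVariety (zeroLocus K (Ideal.span (Set.range F))) ∧
          geomDegree (tangentBundle (zeroLocus K (Ideal.span (Set.range F)))) ≤
            (geomDegree (zeroLocus K (Ideal.span (Set.range F)))) ^ 2 := by
  classical
  obtain ⟨q, hq, h⟩ := main_open (K := K) hrn k hk
  let ψ : CIdx (Fin n) k → Fin r × (Fin n →₀ ℕ) := fun v => (v.1, v.2.1)
  have hψ : Function.Injective ψ := by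
    rintro ⟨i, a, ha⟩ ⟨j, b, hb⟩ h
    have h3 : i = j := congrArg Prod.fst h
    have h4 : a = b := congrArg Prod.snd h
    subst h3; subst h4; rfl
  have hev : ∀ F : Fin r → MvPolynomial (Fin n) K,
      eval (fun v : Fin r × (Fin n →₀ ℕ) => coeff v.2 (F v.1)) (rename ψ q) = eval (cf k F) q := by
    intro F; rw [eval_rename]; rfl
  refine ⟨rename ψ q, ?_, ?_, ?_⟩
  · rwa [Ne, map_eq_zero_iff _ (rename_injective ψ hψ)]
  · have : Infinite K := IsAlgClosed.instInfinite
    obtain ⟨c, hc⟩ : ∃ c, eval c q ≠ 0 := by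
      by_contra hcon
      push Not at hcon
      exact hq (MvPolynomial.funext fun c => by rw [hcon c, map_zero])
    refine ⟨fun i => ofCoeffs (k i) (fun b => c ⟨i, b⟩), fun i => totalDegree_ofCoeffs _ _, ?_⟩
    have h6 := hev (fun i => ofCoeffs (k i) (fun b => c ⟨i, b⟩))
    have h7 : cf k (fun i => ofCoeffs (k i) (fun b => c ⟨i, b⟩)) = c := by
      ext ⟨i, b⟩
      exact coeff_ofCoeffs _ _ _
    rw [h7] at h6
    exact fun h8 => hc (h6.symm.trans h8)
  · intro F hF hne
    rw [hev] at hne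
    exact h F hF hne
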